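/- The orientation-preserving self-homotopy-equivalences Map₁(S²) of the 2-sphere satisfy: the inclusion SO(3) ↪ Map₁(S²) induces an injection on homology with any field coefficients. (This follows from the homotopy equivalence Map₁(S²) ≃ SO(3) × Ω̃, where Ω̃ is the universal cover of the basepoint component of the double loop space Ω²S².) -/

import Mathlib

/-!
**Statement 19**: the inclusion `SO(3) ↪ Map₁(S²)` induces an injection on
singular homology with any field coefficients.

Here `Map₁(S²)` — the space of orientation-preserving (degree 1)
self-homotopy-equivalences of `S²` — is realized as the path component of the
identity in `C(S², S²)` (by Hansen's theorem this is exactly the space of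
degree-1 maps).  The inclusion sends a rotation `A ∈ SO(3)` to the self-map
`v ↦ A·v` of the sphere; it is specified by the hypothesis `hincl`.
-/

open CategoryTheory

noncomputable def singularChainFunctor (R : Type) [CommRing R] :
    TopCat.{0} ⥤ ChainComplex (ModuleCat R) ℕ :=
  TopCat.toSSet ⋙ ((SimplicialObject.whiskering _ _).obj (ModuleCat.free R)) ⋙
    AlgebraicTopology.alternatingFaceMapComplex _

noncomputable def SingularHomology (R : Type) [CommRing R] (n : ℕ) :
    TopCat.{0} ⥤ ModuleCat R :=
  singularChainFunctor R ⋙ HomologicalComplex.homologyFunctor _ _ n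

/-- the 2-sphere -/
abbrev Sph2 : Type := Metric.sphere (0 : EuclideanSpace ℝ (Fin 3)) 1

/-- `Map₁(S²)`: the path component of the identity in `C(S², S²)`, i.e. the
space of degree-1 self-homotopy-equivalences of the 2-sphere -/
noncomputable def Map1S2 : TopCat.{0} :=
  TopCat.of {f : C(Sph2, Sph2) // Joined (ContinuousMap.id Sph2) f}

/-- `SO(3)` with the subspace topology from `3 × 3` real matrices -/
noncomputable def SO3 : TopCat.{0} :=
  TopCat.of (Matrix.specialOrthogonalGroup (Fin 3) ℝ)


namespace S19

theorem hom_map_eq {X Y : TopCat.{0}} {f g : X ⟶ Y} (H : TopCat.Homotopy f g)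
    (F : Type) [Field F] (n : ℕ) :
    (SingularHomology F n).map f = (SingularHomology F n).map g :=
  (SimplicialObject.Homotopy.toChainHomotopy
    (H.toSSet.toSimplicialObjectHomotopy.whiskerRight (ModuleCat.free F))).homologyMap_eq n

/-- simplices of a space in degree `n` -/
abbrev Simp (Y : TopCat.{0}) (n : ℕ) : Type := (TopCat.toSSet.obj Y).obj (Opposite.op (SimplexCategory.mk n))

theorem chain_map_apply {X Y : TopCat.{0}} (F : Type) [Field F] (n : ℕ) (f : X ⟶ Y)
    (b : Simp X n →₀ F) :
    (((singularChainFunctor F).map f).f n (show ((singularChainFunctor F).obj X).X n from b) :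
      ((singularChainFunctor F).obj Y).X n) =
    (show ((singularChainFunctor F).obj Y).X n from
      (Finsupp.mapDomain ((TopCat.toSSet.map f).app (Opposite.op (SimplexCategory.mk n))) b :
        Simp Y n →₀ F)) := rfl

theorem chain_compact_aux {Y : TopCat.{0}} (F : Type) [Field F] (n : ℕ)
    (b : Simp Y n →₀ F) :
    ∃ K₁ : Set Y, IsCompact K₁ ∧ ∀ K : Set Y, K₁ ⊆ K → ∃ b' : Simp (TopCat.of K) n →₀ F,
      Finsupp.mapDomain ((TopCat.toSSet.map (TopCat.ofHom ⟨Subtype.val, continuous_subtype_val⟩ :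
        TopCat.of K ⟶ Y)).app (Opposite.op (SimplexCategory.mk n))) b' = b := by
  induction b using Finsupp.induction_linear with
  | zero => exact ⟨∅, isCompact_empty, fun K _ => ⟨0, Finsupp.mapDomain_zero⟩⟩
  | add a b ha hb =>
    obtain ⟨A, hA, hA'⟩ := ha
    obtain ⟨B, hB, hB'⟩ := hb
    refine ⟨A ∪ B, hA.union hB, fun K hK => ?_⟩
    obtain ⟨a', ha'⟩ := hA' K (Set.subset_union_left.trans hK)
    obtain ⟨b', hb'⟩ := hB' K (Set.subset_union_right.trans hK)
    exact ⟨a' + b', by rw [Finsupp.mapDomain_add, ha', hb']⟩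
  | single s c =>
    let e := TopCat.toSSetObjEquiv Y (Opposite.op (SimplexCategory.mk n))
    refine ⟨Set.range (e s), isCompact_range (e s).continuous, fun K hK => ?_⟩
    refine ⟨Finsupp.single ((TopCat.toSSetObjEquiv (TopCat.of K)
      (Opposite.op (SimplexCategory.mk n))).symm
        ⟨fun x => ⟨e s x, hK ⟨x, rfl⟩⟩, by fun_prop⟩) c, ?_⟩
    rw [Finsupp.mapDomain_single]
    rfl

/-- every finite chain lives on a compact set -/
theorem chain_compact {Y : TopCat.{0}} (F : Type) [Field F] (n : ℕ)
    (b : ((singularChainFunctor F).obj Y).X n) (K₀ : Set Y) (hK₀ : IsCompact K₀) :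
    ∃ K : Set Y, IsCompact K ∧ K₀ ⊆ K ∧ ∃ b' : ((singularChainFunctor F).obj (TopCat.of K)).X n,
      ((singularChainFunctor F).map (TopCat.ofHom ⟨Subtype.val, continuous_subtype_val⟩ :
        TopCat.of K ⟶ Y)).f n b' = b := by
  obtain ⟨K₁, h1, h2⟩ := chain_compact_aux F n b
  obtain ⟨b', hb'⟩ := h2 (K₀ ∪ K₁) Set.subset_union_right
  exact ⟨K₀ ∪ K₁, hK₀.union h1, Set.subset_union_left, b', hb'⟩

theorem chain_inj {X Y : TopCat.{0}} (F : Type) [Field F] (n : ℕ)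
    (f : X ⟶ Y) (hf : Function.Injective f) :
    Function.Injective (((singularChainFunctor F).map f).f n) := by
  refine Finsupp.mapDomain_injective (?_ : Function.Injective
    ((TopCat.toSSet.map f).app (Opposite.op (SimplexCategory.mk n))))
  intro a b hab
  apply (TopCat.toSSetObjEquiv X (Opposite.op (SimplexCategory.mk n))).injective
  ext x
  apply hf
  exact DFunLike.congr_fun (congrArg
    (TopCat.toSSetObjEquiv Y (Opposite.op (SimplexCategory.mk n))) hab) x

theorem injective_of_compact_retract {X Y : TopCat.{0}} [CompactSpace X] (i : X ⟶ Y)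
    (h : ∀ K : Set Y, IsCompact K → ∀ hK : ∀ x, i x ∈ K, ∃ r : TopCat.of K ⟶ X,
      Nonempty (TopCat.Homotopy ((TopCat.ofHom ⟨fun x => ⟨i x, hK x⟩, by fun_prop⟩ :
        X ⟶ TopCat.of K) ≫ r) (𝟙 X)))
    (F : Type) [Field F] (n : ℕ) :
    Function.Injective ((SingularHomology F n).map i) := by
  rw [injective_iff_map_eq_zero]
  intro x hx
  let S := singularChainFunctor F
  obtain ⟨z, rfl⟩ := (ModuleCat.epi_iff_surjective ((S.obj X).homologyπ n)).1 inferInstance x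
  have key : ∀ (W : TopCat.{0}) (f : X ⟶ W),
      (SingularHomology F n).map f ((S.obj X).homologyπ n z) =
        (S.obj W).homologyπ n (HomologicalComplex.cyclesMap (S.map f) n z) := by
    intro W f
    have := HomologicalComplex.homologyπ_naturality (S.map f) n
    exact congrArg (fun φ => φ.hom z) this
  rw [key] at hx
  have ex : (ShortComplex.mk _ _ ((S.obj Y).toCycles_comp_homologyπ (n+1) n)).Exact :=
    ShortComplex.exact_of_g_is_cokernel _ ((S.obj Y).homologyIsCokernel (n+1) n (by simp))
  obtain ⟨b, hb⟩ := (ShortComplex.moduleCat_exact_iff _).1 ex _ hx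
  obtain ⟨K, hK, hiK, b', hb'⟩ := chain_compact F (n+1) b (Set.range i)
    (isCompact_range i.hom.continuous)
  let j : X ⟶ TopCat.of K := TopCat.ofHom ⟨fun x => ⟨i x, hiK ⟨x, rfl⟩⟩, by fun_prop⟩
  let k : TopCat.of K ⟶ Y := TopCat.ofHom ⟨Subtype.val, continuous_subtype_val⟩
  have hjk : j ≫ k = i := rfl
  have hj : (S.obj (TopCat.of K)).toCycles (n+1) n b' =
      HomologicalComplex.cyclesMap (S.map j) n z := by
    apply (ModuleCat.mono_iff_injective ((S.obj (TopCat.of K)).iCycles n)).1 inferInstance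
    apply chain_inj F n k Subtype.val_injective
    have e1 : (S.map k).f n ((S.obj (TopCat.of K)).iCycles n
        ((S.obj (TopCat.of K)).toCycles (n+1) n b')) = (S.obj Y).d (n+1) n b := by
      rw [← hb']
      have h1 := (S.obj (TopCat.of K)).toCycles_i (n+1) n
      have h2 := (S.map k).comm (n+1) n
      have h1' := congrArg (fun φ => φ.hom b') h1
      have h2' := congrArg (fun φ => φ.hom b') h2
      simp only [ModuleCat.hom_comp, LinearMap.comp_apply] at h1' h2'
      erw [h1']
      exact h2'.symm
    have e2 : (S.map k).f n ((S.obj (TopCat.of K)).iCycles n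
        (HomologicalComplex.cyclesMap (S.map j) n z)) = (S.obj Y).iCycles n
          (HomologicalComplex.cyclesMap (S.map i) n z) := by
      have h1 := HomologicalComplex.cyclesMap_i (S.map k) n
      have h1' := congrArg (fun φ => φ.hom (HomologicalComplex.cyclesMap (S.map j) n z)) h1
      have h2 : HomologicalComplex.cyclesMap (S.map i) n =
        HomologicalComplex.cyclesMap (S.map j) n ≫ HomologicalComplex.cyclesMap (S.map k) n := by
        rw [← HomologicalComplex.cyclesMap_comp, ← S.map_comp, hjk]
      rw [h2]
      exact h1'.symm
    have e3 : (S.obj Y).iCycles n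
          (HomologicalComplex.cyclesMap (S.map i) n z) = (S.obj Y).d (n+1) n b := by
      rw [← hb]
      have h1 := (S.obj Y).toCycles_i (n+1) n
      exact congrArg (fun φ => φ.hom b) h1
    exact (e1.trans e3.symm).trans e2.symm
  have hj0 : (SingularHomology F n).map j ((S.obj X).homologyπ n z) = 0 := by
    rw [key, ← hj]
    exact congrArg (fun φ => φ.hom b') ((S.obj (TopCat.of K)).toCycles_comp_homologyπ (n+1) n)
  obtain ⟨r, ⟨H⟩⟩ := h K hK (fun x => hiK ⟨x, rfl⟩)
  have h3 := hom_map_eq H F n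
  rw [Functor.map_comp, CategoryTheory.Functor.map_id] at h3
  have h4 := congrArg (fun φ => φ.hom ((S.obj X).homologyπ n z)) h3
  have h5 : (SingularHomology F n).map r ((SingularHomology F n).map j
    ((S.obj X).homologyπ n z)) = (S.obj X).homologyπ n z := h4
  rw [hj0, map_zero] at h5
  exact h5.symm

end S19

namespace S19

open Complex ComplexConjugate

/-- the 3-sphere inside `ℂ²` -/
abbrev S3 : Type := {v : ℂ × ℂ // normSq v.1 + normSq v.2 = 1}

theorem sph_iff (x : EuclideanSpace ℝ (Fin 3)) :
    x ∈ Metric.sphere (0 : EuclideanSpace ℝ (Fin 3)) 1 ↔ x 0 ^ 2 + x 1 ^ 2 + x 2 ^ 2 = 1 := by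
  rw [mem_sphere_zero_iff_norm, EuclideanSpace.norm_eq, Real.sqrt_eq_one, Fin.sum_univ_three]
  simp only [Real.norm_eq_abs, sq_abs]

/-- raw Hopf map -/
noncomputable def hopfv (v : ℂ × ℂ) : EuclideanSpace ℝ (Fin 3) :=
  !₂[2 * (v.1.re * v.2.re + v.1.im * v.2.im), 2 * (v.1.re * v.2.im - v.1.im * v.2.re),
    normSq v.1 - normSq v.2]

theorem hopfv0 (v : ℂ × ℂ) : hopfv v 0 = 2 * (v.1.re * v.2.re + v.1.im * v.2.im) := rfl
theorem hopfv1 (v : ℂ × ℂ) : hopfv v 1 = 2 * (v.1.re * v.2.im - v.1.im * v.2.re) := rfl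
theorem hopfv2 (v : ℂ × ℂ) : hopfv v 2 = normSq v.1 - normSq v.2 := rfl

theorem S3.eqn (z : S3) : z.1.1.re ^ 2 + z.1.1.im ^ 2 + (z.1.2.re ^ 2 + z.1.2.im ^ 2) = 1 := by
  have := z.2
  rw [normSq_apply, normSq_apply] at this
  linarith

/-- Hopf map -/
noncomputable def hopf (z : S3) : Sph2 := ⟨hopfv z.1, by
  rw [sph_iff, hopfv0, hopfv1, hopfv2, normSq_apply, normSq_apply]
  have := z.eqn
  generalize z.1.1.re = a at *
  generalize z.1.1.im = b at *
  generalize z.1.2.re = c at *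
  generalize z.1.2.im = d at *
  have e : a*a+b*b = 1 - (c^2+d^2) := by linarith
  have : (a^2+b^2+(c^2+d^2))^2 = 1 := by rw [this]; ring
  linarith⟩

theorem continuous_hopf : Continuous hopf := by
  unfold hopf hopfv
  refine Continuous.subtype_mk ?_ _
  refine (PiLp.continuous_toLp 2 _).comp ?_
  refine continuous_pi fun i => ?_
  fin_cases i <;> simp [normSq_apply] <;> fun_prop

theorem compact_S3_aux : IsCompact {v : ℂ × ℂ | normSq v.1 + normSq v.2 = 1} := by
  refine Metric.isCompact_of_isClosed_isBounded ?_ ?_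
  · exact isClosed_eq ((continuous_normSq.comp continuous_fst).add
      (continuous_normSq.comp continuous_snd)) continuous_const
  · refine (Metric.isBounded_closedBall (x := (0 : ℂ × ℂ)) (r := 1)).subset ?_
    intro v hv
    simp only [Set.mem_ofPred_eq] at hv
    rw [mem_closedBall_zero_iff, Prod.norm_def, max_le_iff]
    have h1 := normSq_nonneg v.1
    have h2 := normSq_nonneg v.2
    rw [normSq_eq_norm_sq] at *
    rw [normSq_eq_norm_sq] at *
    constructor <;> nlinarith [norm_nonneg v.1, norm_nonneg v.2]

instance : CompactSpace S3 := isCompact_iff_compactSpace.1 compact_S3_aux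

/-- base point -/
def e3 : S3 := ⟨(1, 0), by simp⟩

theorem circle_sq (u : Circle) : (u : ℂ).re ^ 2 + (u : ℂ).im ^ 2 = 1 := by
  have := Circle.normSq_coe u
  rw [normSq_apply] at this; linarith

/-- circle action -/
def act (u : Circle) (z : S3) : S3 := ⟨(u * z.1.1, u * z.1.2), by
  simp only [normSq_mul, Circle.normSq_coe, one_mul]; exact z.2⟩

theorem act_act (u w : Circle) (z : S3) : act u (act w z) = act (u * w) z := by
  unfold act; ext <;> simp [mul_assoc]

theorem one_act (z : S3) : act 1 z = z := by
  unfold act; ext <;> simp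

theorem continuous_act : Continuous fun p : Circle × S3 => act p.1 p.2 := by
  unfold act
  fun_prop

theorem hopf_act (u : Circle) (z : S3) : hopf (act u z) = hopf z := by
  have hu := circle_sq u
  apply Subtype.ext
  ext i
  fin_cases i
  · change hopfv _ 0 = hopfv _ 0
    rw [hopfv0, hopfv0]
    simp only [act, mul_re, mul_im]
    linear_combination (2 * (z.1.1.re * z.1.2.re + z.1.1.im * z.1.2.im)) * hu
  · change hopfv _ 1 = hopfv _ 1
    rw [hopfv1, hopfv1]
    simp only [act, mul_re, mul_im]
    linear_combination (2 * (z.1.1.re * z.1.2.im - z.1.1.im * z.1.2.re)) * hu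
  · change hopfv _ 2 = hopfv _ 2
    rw [hopfv2, hopfv2]
    simp [act, normSq_mul, Circle.normSq_coe]

/-- hermitian product on `ℂ²` -/
def ip (z z' : ℂ × ℂ) : ℂ := conj z.1 * z'.1 + conj z.2 * z'.2

theorem mul_conj_add (z : S3) : z.1.1 * conj z.1.1 + z.1.2 * conj z.1.2 = 1 := by
  rw [mul_conj, mul_conj]; exact_mod_cast z.2

theorem ip_act (u : Circle) (z : S3) : ip z.1 (act u z).1 = u := by
  simp only [ip, act]
  linear_combination (u : ℂ) * mul_conj_add z

theorem eq_of_hopf {z z' : S3} (h : hopf z = hopf z') :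
    ip z.1 z'.1 * z.1.1 = z'.1.1 ∧ ip z.1 z'.1 * z.1.2 = z'.1.2 := by
  have h0 : hopfv z.1 = hopfv z'.1 := congrArg Subtype.val h
  have a0 : hopfv z.1 0 = hopfv z'.1 0 := by rw [h0]
  have a1 : hopfv z.1 1 = hopfv z'.1 1 := by rw [h0]
  have a2 : hopfv z.1 2 = hopfv z'.1 2 := by rw [h0]
  rw [hopfv0, hopfv0] at a0
  rw [hopfv1, hopfv1] at a1
  rw [hopfv2, hopfv2] at a2
  have k1 : conj z.1.1 * z.1.2 = conj z'.1.1 * z'.1.2 := by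
    apply Complex.ext
    · simp; linarith
    · simp; linarith
  have k1' : conj z.1.2 * z.1.1 = conj z'.1.2 * z'.1.1 := by
    have := congrArg conj k1
    simp at this
    linear_combination this
  have n1 : z.1.1 * conj z.1.1 = z'.1.1 * conj z'.1.1 := by
    rw [mul_conj, mul_conj]; norm_cast; linarith [z.2, z'.2]
  have n2 : z.1.2 * conj z.1.2 = z'.1.2 * conj z'.1.2 := by
    rw [mul_conj, mul_conj]; norm_cast; linarith [z.2, z'.2]
  have := mul_conj_add z'
  unfold ip
  constructor
  · linear_combination z'.1.1 * n1 + z'.1.2 * k1' + z'.1.1 * this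
  · linear_combination z'.1.2 * n2 + z'.1.1 * k1 + z'.1.2 * this

theorem normSq_ip {z z' : S3} (h : hopf z = hopf z') : normSq (ip z.1 z'.1) = 1 := by
  obtain ⟨h1, h2⟩ := eq_of_hopf h
  have := z'.2
  rw [← h1, ← h2, normSq_mul, normSq_mul, ← mul_add, z.2, mul_one] at this
  exact this

/-- the ratio of two points in the same fibre -/
noncomputable def ratio (z z' : S3) (h : hopf z = hopf z') : Circle :=
  ⟨ip z.1 z'.1, by
    change ip z.1 z'.1 ∈ Metric.sphere (0 : ℂ) 1
    rw [mem_sphere_zero_iff_norm]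
    have := normSq_ip h
    rw [normSq_eq_norm_sq] at this
    nlinarith [norm_nonneg (ip z.1 z'.1)]⟩

theorem act_ratio (z z' : S3) (h : hopf z = hopf z') : act (ratio z z' h) z = z' := by
  obtain ⟨h1, h2⟩ := eq_of_hopf h
  apply Subtype.ext
  exact Prod.ext h1 h2

theorem act_inj {u w : Circle} {z : S3} (h : act u z = act w z) : u = w := by
  apply Subtype.ext
  have := ip_act u z
  rw [h, ip_act] at this
  exact this.symm

theorem hopf_surjective : Function.Surjective hopf := by
  intro p
  have hp := (sph_iff _).1 p.2
  set x := (p.1 : EuclideanSpace ℝ (Fin 3)) with hx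
  by_cases h : x 2 = -1
  · refine ⟨⟨(0, 1), by simp⟩, ?_⟩
    have : x 0 ^ 2 + x 1 ^ 2 = 0 := by rw [h] at hp; linarith
    have h0 : x 0 = 0 := by nlinarith [sq_nonneg (x 0), sq_nonneg (x 1)]
    have h1 : x 1 = 0 := by nlinarith [sq_nonneg (x 0), sq_nonneg (x 1)]
    apply Subtype.ext
    ext i
    fin_cases i
    · change hopfv _ 0 = x 0
      rw [hopfv0, h0]; simp
    · change hopfv _ 1 = x 1
      rw [hopfv1, h1]; simp
    · change hopfv _ 2 = x 2
      rw [hopfv2, h]; simp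
  · have hgt : 0 < 1 + x 2 := by
      have : (x 2) ^ 2 ≤ 1 := by nlinarith [sq_nonneg (x 0), sq_nonneg (x 1)]
      have h3 := (abs_le.1 ((sq_le_one_iff_abs_le_one _).1 this)).1
      rcases h3.lt_or_eq with h3 | h3
      · linarith
      · exact absurd h3.symm h
    obtain ⟨s, hs, hs2⟩ : ∃ s : ℝ, 0 < s ∧ s ^ 2 = (1 + x 2) / 2 :=
      ⟨Real.sqrt ((1 + x 2) / 2), Real.sqrt_pos.2 (by linarith), Real.sq_sqrt (by linarith)⟩
    have hkey : (x 0 ^ 2 + x 1 ^ 2) = 4 * s ^ 2 * (1 - s ^ 2) := by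
      rw [hs2]; nlinarith
    have hn : normSq (⟨x 0 / (2 * s), x 1 / (2 * s)⟩ : ℂ) = 1 - s ^ 2 := by
      rw [normSq_apply]; field_simp; linarith
    refine ⟨⟨((s : ℂ), ⟨x 0 / (2 * s), x 1 / (2 * s)⟩), ?_⟩, ?_⟩
    · simp only [hn, normSq_ofReal]; ring
    · apply Subtype.ext
      ext i
      fin_cases i
      · change hopfv _ 0 = x 0
        rw [hopfv0]; simp; field_simp
      · change hopfv _ 1 = x 1
        rw [hopfv1]; simp; field_simp
      · change hopfv _ 2 = x 2
        rw [hopfv2]; simp only [hn, normSq_ofReal]; linarith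

theorem hopf_quot : Topology.IsQuotientMap hopf :=
  (continuous_hopf.isClosedMap).isQuotientMap continuous_hopf hopf_surjective

end S19

namespace S19
open Complex ComplexConjugate

/-- matrix with third column `p` and first two columns built from a quadratic tensor -/
def Rmat (p : EuclideanSpace ℝ (Fin 3)) (A B C : ℂ) : Matrix (Fin 3) (Fin 3) ℝ :=
  !![A.re - C.re, A.im - C.im, p 0; -A.im - C.im, A.re + C.re, p 1; -2 * B.re, -2 * B.im, p 2]

theorem continuous_Rmat :
    Continuous fun q : EuclideanSpace ℝ (Fin 3) × ℂ × ℂ × ℂ => Rmat q.1 q.2.1 q.2.2.1 q.2.2.2 := by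
  unfold Rmat
  refine continuous_matrix fun i j => ?_
  fin_cases i <;> fin_cases j <;> simp <;> fun_prop

/-- rotation attached to a point of the 3-sphere -/
noncomputable def Rv (v : S3) : Matrix (Fin 3) (Fin 3) ℝ :=
  Rmat (hopfv v.1) (v.1.1 ^ 2) (v.1.1 * v.1.2) (v.1.2 ^ 2)

theorem Rv_mem (v : S3) : Rv v ∈ Matrix.specialOrthogonalGroup (Fin 3) ℝ := by
  have h := v.eqn
  rw [Matrix.mem_specialOrthogonalGroup_iff, Matrix.mem_orthogonalGroup_iff]
  have e0 := hopfv0 v.1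
  have e1 := hopfv1 v.1
  have e2 := hopfv2 v.1
  rw [normSq_apply, normSq_apply] at e2
  unfold Rv Rmat
  generalize hopfv v.1 0 = h0 at *
  generalize hopfv v.1 1 = h1 at *
  generalize hopfv v.1 2 = h2 at *
  generalize v.1 = w at *
  obtain ⟨⟨a, b⟩, ⟨c, d⟩⟩ := w
  simp only at *
  have h' : (a ^ 2 + b ^ 2 + (c ^ 2 + d ^ 2)) ^ 2 = 1 := by rw [h]; ring
  have h'' : (a ^ 2 + b ^ 2 + (c ^ 2 + d ^ 2)) ^ 3 = 1 := by rw [h]; ring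
  subst e0 e1 e2
  constructor
  · ext i j
    fin_cases i <;> fin_cases j <;>
      simp [Matrix.mul_apply, Fin.sum_univ_three, pow_two] <;>
      first | ring1 | linear_combination h'
  · rw [Matrix.det_fin_three]
    simp [pow_two]
    rw [← h'']
    ring

/-- the linear self map of the 3-sphere attached to `v` -/
noncomputable def Uact (v z : S3) : S3 :=
  ⟨(v.1.1 * z.1.1 - conj v.1.2 * z.1.2, v.1.2 * z.1.1 + conj v.1.1 * z.1.2), by
    have h1 := v.eqn
    have h2 := z.eqn
    simp only [normSq_apply, mul_re, mul_im, sub_re, sub_im, add_re, add_im, conj_re, conj_im]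
    linear_combination (z.1.1.re ^ 2 + z.1.1.im ^ 2 + (z.1.2.re ^ 2 + z.1.2.im ^ 2)) * h1 + h2⟩

theorem continuous_Uact : Continuous fun p : S3 × S3 => Uact p.1 p.2 := by
  unfold Uact
  fun_prop

theorem hopf_Uact (v z : S3) :
    ((hopf (Uact v z)).1 : Fin 3 → ℝ) = Matrix.mulVec (Rv v) ((hopf z).1 : Fin 3 → ℝ) := by
  have e0 := hopfv0 (Uact v z).1
  have e1 := hopfv1 (Uact v z).1
  have e2 := hopfv2 (Uact v z).1
  ext i
  change hopfv (Uact v z).1 i = _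
  simp only [Uact, normSq_apply, mul_re, mul_im, sub_re, sub_im, add_re, add_im, conj_re, conj_im]
    at e0 e1 e2
  fin_cases i
  · change hopfv (Uact v z).1 0 = _
    simp [Matrix.mulVec, dotProduct, Fin.sum_univ_three, Rv, Rmat, hopf, hopfv0, hopfv1, hopfv2, pow_two, normSq_apply, Uact]
    ring
  · change hopfv (Uact v z).1 1 = _
    simp [Matrix.mulVec, dotProduct, Fin.sum_univ_three, Rv, Rmat, hopf, hopfv0, hopfv1, hopfv2, pow_two, normSq_apply, Uact]
    ring
  · change hopfv (Uact v z).1 2 = _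
    simp [Matrix.mulVec, dotProduct, Fin.sum_univ_three, Rv, Rmat, hopf, hopfv0, hopfv1, hopfv2, pow_two, normSq_apply, Uact]
    ring

theorem Uact_e3 (v : S3) : Uact v e3 = v := by
  apply Subtype.ext; simp [Uact, e3]

theorem Uact_act (u : Circle) (v z : S3) : Uact v (act u z) = act u (Uact v z) := by
  apply Subtype.ext
  simp only [Uact, act]
  ext1 <;> simp only <;> ring

/-- the rotation twisted by a phase -/
noncomputable def Tm (v : S3) (d : Circle) : Matrix (Fin 3) (Fin 3) ℝ :=
  Rmat (hopf v).1 (conj (d : ℂ) * v.1.1 ^ 2) (conj (d : ℂ) * (v.1.1 * v.1.2))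
    (conj (d : ℂ) * v.1.2 ^ 2)

theorem continuous_Tm : Continuous fun p : S3 × Circle => Tm p.1 p.2 := by
  unfold Tm
  have h1 : Continuous fun p : S3 × Circle => ((hopf p.1).1,
    conj (p.2 : ℂ) * p.1.1.1 ^ 2, conj (p.2 : ℂ) * (p.1.1.1 * p.1.1.2),
    conj (p.2 : ℂ) * p.1.1.2 ^ 2) := by
    have h3 : Continuous fun p : S3 × Circle => (hopf p.1).1 :=
      continuous_subtype_val.comp (continuous_hopf.comp continuous_fst)
    have h2 : Continuous fun p : S3 × Circle => conj (p.2 : ℂ) :=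
      continuous_conj.comp (by fun_prop)
    exact h3.prodMk (by fun_prop)
  exact continuous_Rmat.comp h1

theorem Tm_one (v : S3) : Tm v 1 = Rv v := by
  simp [Tm, Rv, hopf]

theorem Tm_act (u d : Circle) (v : S3) : Tm (act u v) (u ^ 2 * d) = Tm v d := by
  have h : conj (u : ℂ) * u = 1 := by
    rw [mul_comm, mul_conj, Circle.normSq_coe]; simp
  unfold Tm
  rw [hopf_act]
  simp only [act, Circle.coe_mul, Circle.coe_pow, map_mul, map_pow]
  congr 1
  · linear_combination (conj (d : ℂ)) * v.1.1 ^ 2 * (conj (u : ℂ) * u + 1) * h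
  · linear_combination (conj (d : ℂ)) * (v.1.1 * v.1.2) * (conj (u : ℂ) * u + 1) * h
  · linear_combination (conj (d : ℂ)) * v.1.2 ^ 2 * (conj (u : ℂ) * u + 1) * h

theorem circle_sqrt (d : Circle) : ∃ w : Circle, w ^ 2 = d := by
  refine ⟨Circle.exp (arg d / 2), ?_⟩
  rw [← Circle.exp_nsmul]
  simp [mul_div_cancel₀]

theorem Tm_eq_Rv (v : S3) (d : Circle) : ∃ v', Tm v d = Rv v' ∧ hopf v' = hopf v := by
  obtain ⟨w, rfl⟩ := circle_sqrt d
  refine ⟨act w⁻¹ v, ?_, hopf_act _ _⟩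
  rw [← Tm_one, ← Tm_act w⁻¹]
  congr 1
  simp

theorem Tm_mem (v : S3) (d : Circle) : Tm v d ∈ Matrix.specialOrthogonalGroup (Fin 3) ℝ := by
  obtain ⟨v', h, -⟩ := Tm_eq_Rv v d
  rw [h]; exact Rv_mem v'

theorem Rv_inj {v v' : S3} (h : Rv v = Rv v') : ∃ u : Circle, u ^ 2 = 1 ∧ v' = act u v := by
  have hh : hopf v = hopf v' := by
    apply Subtype.ext
    ext i
    have := congrFun (congrFun h i) 2
    fin_cases i <;> simpa [Rv, Rmat, hopf] using this
  have e1 := act_ratio v v' hh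
  set u := ratio v v' hh
  refine ⟨u, ?_, e1.symm⟩
  have a00 := congrFun (congrFun h 0) 0
  have a01 := congrFun (congrFun h 0) 1
  have a10 := congrFun (congrFun h 1) 0
  have a11 := congrFun (congrFun h 1) 1
  simp only [Rv, Rmat, Matrix.of_apply, Matrix.cons_val', Matrix.cons_val_zero, Matrix.cons_val_one,
    Matrix.cons_val_fin_one] at a00 a01 a10 a11
  have q1 : v.1.1 ^ 2 = v'.1.1 ^ 2 := by
    apply Complex.ext <;> linarith
  have q2 : v.1.2 ^ 2 = v'.1.2 ^ 2 := by
    apply Complex.ext <;> linarith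
  rw [← e1] at q1 q2
  simp only [act] at q1 q2
  apply Subtype.ext
  have n := mul_conj_add v
  simp only [Circle.coe_pow, Circle.coe_one]
  rcases eq_or_ne v.1.1 0 with h0 | h0
  · have h1 : v.1.2 ≠ 0 := by
      intro h1; rw [h0, h1] at n; simp at n
    have : v.1.2 ^ 2 ≠ 0 := pow_ne_zero _ h1
    apply mul_right_cancel₀ this
    linear_combination -q2
  · have : v.1.1 ^ 2 ≠ 0 := pow_ne_zero _ h0
    apply mul_right_cancel₀ this
    linear_combination -q1

theorem Rv_surj (A : Matrix.specialOrthogonalGroup (Fin 3) ℝ) : ∃ v, Rv v = A.1 := by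
  obtain ⟨hA, hdet⟩ := Matrix.mem_specialOrthogonalGroup_iff.1 A.2
  have hA' := hA
  rw [Matrix.mem_orthogonalGroup_iff'] at hA'
  have col : ∀ i j, ∑ k, A.1 k i * A.1 k j = (1 : Matrix (Fin 3) (Fin 3) ℝ) i j := by
    intro i j
    rw [← hA']
    simp [Matrix.mul_apply]
  obtain ⟨v, hv⟩ := hopf_surjective ⟨!₂[A.1 0 2, A.1 1 2, A.1 2 2], by
    rw [sph_iff]
    have := col 2 2
    simp [Fin.sum_univ_three] at this
    simp
    linarith⟩
  obtain ⟨hR, hRdet⟩ := Matrix.mem_specialOrthogonalGroup_iff.1 (Rv_mem v)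
  have hR' := hR
  rw [Matrix.mem_orthogonalGroup_iff] at hR
  rw [Matrix.mem_orthogonalGroup_iff'] at hR'
  -- `B = R(v)ᵀ A`
  set B : Matrix (Fin 3) (Fin 3) ℝ := (Rv v).transpose * A.1 with hB
  have hAB : A.1 = Rv v * B := by
    rw [hB, ← mul_assoc, hR, one_mul]
  have hBmem : B * B.transpose = 1 := by
    rw [Matrix.mem_orthogonalGroup_iff] at hA
    rw [hB, Matrix.transpose_mul, Matrix.transpose_transpose]
    calc (Rv v).transpose * A.1 * (A.1.transpose * Rv v) =
            (Rv v).transpose * (A.1 * A.1.transpose) * Rv v := by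
          simp only [mul_assoc]
      _ = 1 := by rw [hA, mul_one, hR']
  have hBmem' : B.transpose * B = 1 := mul_eq_one_comm.1 hBmem
  have hBdet : B.det = 1 := by
    have := congrArg Matrix.det hAB
    rw [Matrix.det_mul, hRdet, hdet, one_mul] at this
    exact this.symm
  have hcol : ∀ k, Rv v k 2 = A.1 k 2 := by
    intro k
    have := congrArg (fun x : Sph2 => x.1 k) hv
    fin_cases k <;> simpa [Rv, Rmat, hopf] using this
  have hB2 : ∀ i, B i 2 = (1 : Matrix (Fin 3) (Fin 3) ℝ) i 2 := by
    intro i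
    rw [← hR', hB, Matrix.mul_apply, Matrix.mul_apply]
    simp_rw [hcol]
  have b02 : B 0 2 = 0 := by rw [hB2]; simp
  have b12 : B 1 2 = 0 := by rw [hB2]; simp
  have b22 : B 2 2 = 1 := by rw [hB2]; simp
  have o22 := congrFun (congrFun hBmem 2) 2
  simp [Matrix.mul_apply, Fin.sum_univ_three, b22] at o22
  have b20 : B 2 0 = 0 := by nlinarith [mul_self_nonneg (B 2 0), mul_self_nonneg (B 2 1)]
  have b21 : B 2 1 = 0 := by nlinarith [mul_self_nonneg (B 2 0), mul_self_nonneg (B 2 1)]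
  have o00 := congrFun (congrFun hBmem' 0) 0
  have o01 := congrFun (congrFun hBmem' 0) 1
  have o11 := congrFun (congrFun hBmem' 1) 1
  simp [Matrix.mul_apply, Fin.sum_univ_three, b20, b21] at o00 o01 o11
  rw [Matrix.det_fin_three, b02, b12, b22, b20, b21] at hBdet
  have b11 : B 1 1 = B 0 0 := by
    linear_combination (-B 1 1) * o00 + (B 1 0) * o01 + B 0 0 * hBdet
  have b01 : B 0 1 = - B 1 0 := by
    linear_combination (-B 0 1) * o00 + (B 0 0) * o01 - B 1 0 * hBdet
  obtain ⟨u, hu⟩ := circle_sqrt ⟨⟨B 0 0, - B 1 0⟩, by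
    change _ ∈ Metric.sphere (0 : ℂ) 1
    rw [mem_sphere_zero_iff_norm, ← sq_eq_sq₀ (norm_nonneg _) zero_le_one, ← normSq_eq_norm_sq,
      normSq_apply]
    simp; linarith⟩
  have hu' : (u : ℂ) ^ 2 = ⟨B 0 0, - B 1 0⟩ := by
    rw [← Circle.coe_pow, hu]
  refine ⟨act u v, ?_⟩
  rw [hAB]
  have r := congrArg Complex.re hu'
  have i := congrArg Complex.im hu'
  simp only at r i
  have key : Rv (act u v) = Rmat (hopf v).1 ((u : ℂ) ^ 2 * v.1.1 ^ 2) ((u : ℂ) ^ 2 * (v.1.1 * v.1.2))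
      ((u : ℂ) ^ 2 * v.1.2 ^ 2) := by
    unfold Rv
    have : hopfv (act u v).1 = (hopf v).1 := by rw [← hopf_act u]; rfl
    rw [this]
    simp only [act]
    congr 1 <;> ring
  rw [key, hu']
  ext k l
  rw [Matrix.mul_apply, Fin.sum_univ_three]
  fin_cases k <;> fin_cases l <;>
    simp [Rv, Rmat, hopf, b02, b12, b22, b20, b21, b11, b01] <;> ring

theorem continuous_Rv : Continuous Rv := by
  have h1 : Continuous fun v : S3 => (v, (1 : Circle)) := by fun_prop
  have h2 := continuous_Tm.comp h1
  refine h2.congr fun v => ?_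
  exact Tm_one v

/-- `S³ → SO(3)` -/
noncomputable def Rso (v : S3) : Matrix.specialOrthogonalGroup (Fin 3) ℝ := ⟨Rv v, Rv_mem v⟩

theorem continuous_Rso : Continuous Rso := Continuous.subtype_mk continuous_Rv _

theorem Rso_surj : Function.Surjective Rso := by
  intro A
  obtain ⟨v, hv⟩ := Rv_surj A
  exact ⟨v, Subtype.ext hv⟩

theorem compact_SO3 : CompactSpace (Matrix.specialOrthogonalGroup (Fin 3) ℝ) :=
  Rso_surj.compactSpace continuous_Rso

theorem Rso_quot : Topology.IsQuotientMap Rso :=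
  (continuous_Rso.isClosedMap).isQuotientMap continuous_Rso Rso_surj

end S19

namespace S19
open Complex ComplexConjugate

/-- dot product on the 2-sphere -/
def dot (p q : Sph2) : ℝ := p.1 0 * q.1 0 + p.1 1 * q.1 1 + p.1 2 * q.1 2

theorem dot_pos {p q : Sph2} (h : dist p q < 2) : 0 < 1 + dot p q := by
  have h1 := (sph_iff _).1 p.2
  have h2 := (sph_iff _).1 q.2
  rw [Subtype.dist_eq, EuclideanSpace.dist_eq, Real.sqrt_lt' (by norm_num),
    Fin.sum_univ_three] at h
  simp only [Real.dist_eq, sq_abs] at h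
  unfold dot
  nlinarith

/-- unnormalised projection of `v` to the line of `p` -/
noncomputable def projv (p : Sph2) (v : S3) : ℂ × ℂ :=
  (((1 + p.1 2 : ℝ) * v.1.1 + (⟨p.1 0, - p.1 1⟩ : ℂ) * v.1.2) / 2,
   ((⟨p.1 0, p.1 1⟩ : ℂ) * v.1.1 + (1 - p.1 2 : ℝ) * v.1.2) / 2)

theorem projv_normSq (p : Sph2) (v : S3) :
    normSq (projv p v).1 + normSq (projv p v).2 = (1 + dot p (hopf v)) / 2 := by
  have h1 := (sph_iff _).1 p.2
  have h2 := v.eqn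
  have e0 := hopfv0 v.1
  have e1 := hopfv1 v.1
  have e2 := hopfv2 v.1
  rw [normSq_apply, normSq_apply] at e2
  simp only [dot, hopf, projv, e0, e1, e2]
  simp [normSq_apply, mul_re, mul_im]
  generalize p.1 0 = x at *
  generalize p.1 1 = y at *
  generalize p.1 2 = t at *
  generalize v.1 = w at *
  obtain ⟨⟨a, b⟩, ⟨c, d⟩⟩ := w
  simp only at *
  linear_combination (1/4) * (a^2+b^2+c^2+d^2) * h1 + (1/2) * h2

theorem projv_hopf (p : Sph2) (v : S3) :
    hopfv (projv p v) = ((1 + dot p (hopf v)) / 2) • p.1 := by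
  have h1 := (sph_iff _).1 p.2
  have h2 := v.eqn
  have e0 := hopfv0 v.1
  have e1 := hopfv1 v.1
  have e2 := hopfv2 v.1
  rw [normSq_apply, normSq_apply] at e2
  ext i
  simp only [dot, hopf, e0, e1, e2, PiLp.smul_apply, smul_eq_mul]
  fin_cases i
  · refine (hopfv0 (projv p v)).trans ?_
    simp [projv, normSq_apply]
    generalize p.1 0 = x at *
    generalize p.1 1 = y at *
    generalize p.1 2 = t at *
    generalize v.1 = w at *
    obtain ⟨⟨a, b⟩, ⟨c, d⟩⟩ := w
    simp only at *
    linear_combination (-(1/2)*(a * c + b*d)) * h1 + (x/2)*h2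
  · refine (hopfv1 (projv p v)).trans ?_
    simp [projv, normSq_apply]
    generalize p.1 0 = x at *
    generalize p.1 1 = y at *
    generalize p.1 2 = t at *
    generalize v.1 = w at *
    obtain ⟨⟨a, b⟩, ⟨c, d⟩⟩ := w
    simp only at *
    linear_combination (-(1/2)*(a * d - b*c)) * h1 + (y/2)*h2
  · refine (hopfv2 (projv p v)).trans ?_
    simp [projv, normSq_apply]
    generalize p.1 0 = x at *
    generalize p.1 1 = y at *
    generalize p.1 2 = t at *
    generalize v.1 = w at *
    obtain ⟨⟨a, b⟩, ⟨c, d⟩⟩ := w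
    simp only at *
    linear_combination (-(1/4)*(a^2+b^2-c^2-d^2)) * h1 + (t/2)*h2

theorem hopfv_smul (c : ℝ) (w : ℂ × ℂ) : hopfv ((c : ℂ) * w.1, (c : ℂ) * w.2) = (c ^ 2) • hopfv w := by
  ext i
  fin_cases i
  · change hopfv _ 0 = c ^ 2 * hopfv _ 0
    rw [hopfv0, hopfv0]; simp; ring
  · change hopfv _ 1 = c ^ 2 * hopfv _ 1
    rw [hopfv1, hopfv1]; simp; ring
  · change hopfv _ 2 = c ^ 2 * hopfv _ 2
    rw [hopfv2, hopfv2]; simp; ring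

/-- the domain of the projection -/
abbrev PD : Type := {q : Sph2 × S3 // 0 < 1 + dot q.1 (hopf q.2)}

/-- normalising constant -/
noncomputable def pc (q : PD) : ℝ := (Real.sqrt ((1 + dot q.1.1 (hopf q.1.2)) / 2))⁻¹

theorem pc_sq (q : PD) : pc q ^ 2 * ((1 + dot q.1.1 (hopf q.1.2)) / 2) = 1 := by
  have h := q.2
  unfold pc
  rw [inv_pow, Real.sq_sqrt (by linarith)]
  field_simp

/-- normalised projection -/
noncomputable def nproj (q : PD) : S3 :=
  ⟨((pc q : ℂ) * (projv q.1.1 q.1.2).1, (pc q : ℂ) * (projv q.1.1 q.1.2).2), by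
    simp only [normSq_mul, normSq_ofReal]
    rw [← mul_add, projv_normSq, ← pow_two, pc_sq]⟩

theorem hopf_nproj (q : PD) : hopf (nproj q) = q.1.1 := by
  apply Subtype.ext
  change hopfv ((pc q : ℂ) * (projv q.1.1 q.1.2).1, (pc q : ℂ) * (projv q.1.1 q.1.2).2) = _
  rw [hopfv_smul, projv_hopf, smul_smul, pc_sq, one_smul]

theorem continuous_nproj : Continuous nproj := by
  have hh : Continuous fun q : PD => (hopf q.1.2).1 :=
    continuous_subtype_val.comp (continuous_hopf.comp (by fun_prop))
  have hp : Continuous fun q : PD => q.1.1.1 := by fun_prop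
  have hh' : ∀ i, Continuous fun q : PD => (hopf q.1.2).1 i := fun i =>
    (continuous_apply i).comp ((PiLp.continuous_ofLp 2 _).comp hh)
  have hp' : ∀ i, Continuous fun q : PD => q.1.1.1 i := fun i =>
    (continuous_apply i).comp ((PiLp.continuous_ofLp 2 _).comp hp)
  have hpc : Continuous pc := by
    unfold pc
    refine Continuous.inv₀ ?_ ?_
    · refine Real.continuous_sqrt.comp ?_
      unfold dot
      have a0 := hh' 0
      have a1 := hh' 1
      have a2 := hh' 2
      have b0 := hp' 0
      have b1 := hp' 1
      have b2 := hp' 2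
      exact ((continuous_const.add (((b0.mul a0).add (b1.mul a1)).add (b2.mul a2))).div_const 2)
    · intro q
      have := q.2
      exact (Real.sqrt_pos.2 (by linarith)).ne'
  have hc1 : Continuous fun q : PD => (⟨q.1.1.1 0, - q.1.1.1 1⟩ : ℂ) := by
    have : (fun q : PD => (⟨q.1.1.1 0, - q.1.1.1 1⟩ : ℂ)) =
      fun q => ((q.1.1.1 0 : ℝ) : ℂ) - (q.1.1.1 1 : ℝ) * I := by
      ext1 q
      apply Complex.ext <;> simp
    rw [this]
    exact (continuous_ofReal.comp (hp' 0)).sub ((continuous_ofReal.comp (hp' 1)).mul continuous_const)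
  have hc2 : Continuous fun q : PD => (⟨q.1.1.1 0, q.1.1.1 1⟩ : ℂ) := by
    have : (fun q : PD => (⟨q.1.1.1 0, q.1.1.1 1⟩ : ℂ)) =
      fun q => ((q.1.1.1 0 : ℝ) : ℂ) + (q.1.1.1 1 : ℝ) * I := by
      ext1 q
      apply Complex.ext <;> simp
    rw [this]
    exact (continuous_ofReal.comp (hp' 0)).add ((continuous_ofReal.comp (hp' 1)).mul continuous_const)
  have hv1 : Continuous fun q : PD => q.1.2.1.1 := by fun_prop
  have hv2 : Continuous fun q : PD => q.1.2.1.2 := by fun_prop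
  refine Continuous.subtype_mk ?_ _
  unfold projv
  refine Continuous.prodMk ?_ ?_
  · refine (continuous_ofReal.comp hpc).mul (Continuous.div_const ?_ _)
    exact ((continuous_ofReal.comp (continuous_const.add (hp' 2))).mul hv1).add (hc1.mul hv2)
  · refine (continuous_ofReal.comp hpc).mul (Continuous.div_const ?_ _)
    exact (hc2.mul hv1).add ((continuous_ofReal.comp (continuous_const.sub (hp' 2))).mul hv2)

theorem nproj_act (u : Circle) (q q' : PD) (h1 : q'.1.1 = q.1.1) (h2 : q'.1.2 = act u q.1.2) :
    nproj q' = act u (nproj q) := by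
  have hpc : pc q' = pc q := by
    unfold pc
    rw [h1, h2, hopf_act]
  apply Subtype.ext
  simp only [nproj, hpc, act, projv, h1, h2]
  ext1 <;> simp only <;> ring

/-- lifts of a self map of the 2-sphere to equivariant maps of the 3-sphere -/
def IsLift (f : C(Sph2, Sph2)) (F : C(S3, S3)) : Prop :=
  (∀ u z, F (act u z) = act u (F z)) ∧ ∀ z, hopf (F z) = f (hopf z)

theorem sl_aux {f0 f : C(Sph2, Sph2)} {F0 : C(S3, S3)} (h0 : IsLift f0 F0) (h : dist f f0 < 2)
    (z : S3) : 0 < 1 + dot (f (hopf z)) (hopf (F0 z)) := by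
  apply dot_pos
  rw [h0.2]
  exact (ContinuousMap.dist_apply_le_dist (hopf z)).trans_lt h

open Classical in
/-- the local lift near a map which has a lift -/
noncomputable def sl (f0 : C(Sph2, Sph2)) (F0 : C(S3, S3)) (h0 : IsLift f0 F0)
    (f : C(Sph2, Sph2)) : C(S3, S3) :=
  if h : dist f f0 < 2 then
    ⟨fun z => nproj ⟨(f (hopf z), F0 z), sl_aux h0 h z⟩, by
      refine continuous_nproj.comp (Continuous.subtype_mk ?_ _)
      have := continuous_hopf
      exact (f.continuous.comp this).prodMk F0.continuous⟩
  else F0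

theorem sl_isLift {f0 f : C(Sph2, Sph2)} {F0 : C(S3, S3)} (h0 : IsLift f0 F0)
    (h : dist f f0 < 2) : IsLift f (sl f0 F0 h0 f) := by
  unfold sl
  rw [dif_pos h]
  refine ⟨fun u z => ?_, fun z => hopf_nproj _⟩
  refine nproj_act u _ _ ?_ ?_
  · simp [hopf_act]
  · simp [h0.1]

theorem sl_cont {f0 : C(Sph2, Sph2)} {F0 : C(S3, S3)} (h0 : IsLift f0 F0) :
    ContinuousOn (sl f0 F0 h0) (Metric.ball f0 2) := by
  rw [continuousOn_iff_continuous_domRestrict]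
  let G : C(Metric.ball f0 2 × S3, S3) :=
    ⟨fun q => nproj ⟨(q.1.1 (hopf q.2), F0 q.2), sl_aux h0 q.1.2 q.2⟩, by
      refine continuous_nproj.comp (Continuous.subtype_mk ?_ _)
      have h1 : Continuous fun q : Metric.ball f0 2 × S3 => q.1.1 (hopf q.2) := by
        have h2 : Continuous fun q : Metric.ball f0 2 × S3 => hopf q.2 :=
          continuous_hopf.comp continuous_snd
        have h3 : Continuous fun q : Metric.ball f0 2 × S3 => q.1.1 := by fun_prop
        exact h3.eval h2
      exact h1.prodMk (F0.continuous.comp continuous_snd)⟩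
  refine G.curry.continuous.congr fun f => ?_
  have : dist f.1 f0 < 2 := f.2
  ext1 z
  simp [sl, this, G]

theorem isLift_id : IsLift (ContinuousMap.id Sph2) (ContinuousMap.id S3) :=
  ⟨fun _ _ => rfl, fun _ => rfl⟩

theorem exists_lift {f : C(Sph2, Sph2)} (h : Joined (ContinuousMap.id Sph2) f) :
    ∃ F, IsLift f F := by
  have hcl : IsClopen {f : C(Sph2, Sph2) | ∃ F, IsLift f F} := by
    constructor
    · rw [← closure_subset_iff_isClosed]
      intro f hf
      obtain ⟨f0, ⟨F0, h0⟩, hd⟩ := Metric.mem_closure_iff.1 hf 2 (by norm_num)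
      exact ⟨_, sl_isLift h0 hd⟩
    · rw [Metric.isOpen_iff]
      rintro f0 ⟨F0, h0⟩
      exact ⟨2, by norm_num, fun f hf => ⟨_, sl_isLift h0 hf⟩⟩
  have h1 := hcl.connectedComponent_subset
    (show ContinuousMap.id Sph2 ∈ {f : C(Sph2, Sph2) | ∃ F, IsLift f F} from ⟨_, isLift_id⟩)
  exact h1 (pathComponent_subset_component _ h)

/-- the linear lift as a continuous map -/
noncomputable def Ulift (v : S3) : C(S3, S3) :=
  ⟨Uact v, continuous_Uact.comp (by fun_prop : Continuous fun z : S3 => (v, z))⟩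

theorem continuous_Ulift : Continuous Ulift := by
  let G : C(S3 × S3, S3) := ⟨_, continuous_Uact⟩
  exact G.curry.continuous

theorem Ulift_isLift (v : S3) (f : C(Sph2, Sph2))
    (hf : ∀ x : Sph2, ((f x).1 : Fin 3 → ℝ) = Matrix.mulVec (Rv v) (x.1 : Fin 3 → ℝ)) :
    IsLift f (Ulift v) := by
  refine ⟨fun u z => Uact_act u v z, fun z => ?_⟩
  apply Subtype.ext
  have h1 := hopf_Uact v z
  rw [← hf] at h1
  ext i
  exact congrFun h1 i

end S19

namespace S19
open Complex ComplexConjugate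

/-- Euclidean 3-space -/
abbrev E3 : Type := EuclideanSpace ℝ (Fin 3)

theorem sinc_mul (r : ℝ) : Real.sinc r * r = Real.sin r := by
  rcases eq_or_ne r 0 with rfl | h
  · simp
  · rw [Real.sinc_of_ne_zero h]; field_simp

theorem norm_sq_E3 (v : E3) : ‖v‖ ^ 2 = v 0 ^ 2 + v 1 ^ 2 + v 2 ^ 2 := by
  rw [EuclideanSpace.norm_sq_eq, Fin.sum_univ_three]
  simp only [Real.norm_eq_abs, sq_abs]

/-- exponential map onto the 3-sphere -/
noncomputable def qmap (v : E3) : S3 :=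
  ⟨(⟨Real.cos ‖v‖, Real.sinc ‖v‖ * v 0⟩, ⟨Real.sinc ‖v‖ * v 1, Real.sinc ‖v‖ * v 2⟩), by
    simp only [normSq_mk]
    have h1 := norm_sq_E3 v
    have h2 := sinc_mul ‖v‖
    have h3 := Real.sin_sq_add_cos_sq ‖v‖
    rw [← h2] at h3
    linear_combination h3 - (Real.sinc ‖v‖) ^ 2 * h1⟩

theorem continuous_mk_complex {X : Type*} [TopologicalSpace X] {a b : X → ℝ} (ha : Continuous a)
    (hb : Continuous b) : Continuous fun x => (⟨a x, b x⟩ : ℂ) := by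
  have : (fun x => (⟨a x, b x⟩ : ℂ)) = fun x => (a x : ℂ) + (b x : ℂ) * I := by
    ext1 x
    apply Complex.ext <;> simp
  rw [this]
  exact (continuous_ofReal.comp ha).add ((continuous_ofReal.comp hb).mul continuous_const)

theorem continuous_qmap : Continuous qmap := by
  have hs : Continuous fun v : E3 => Real.sinc ‖v‖ := Real.continuous_sinc.comp continuous_norm
  have hc : Continuous fun v : E3 => Real.cos ‖v‖ := Real.continuous_cos.comp continuous_norm
  have hv : ∀ i, Continuous fun v : E3 => v i := fun i =>
    (continuous_apply i).comp (PiLp.continuous_ofLp 2 _)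
  refine Continuous.subtype_mk ?_ _
  exact (continuous_mk_complex hc (hs.mul (hv 0))).prodMk
    (continuous_mk_complex (hs.mul (hv 1)) (hs.mul (hv 2)))

theorem qmap_surj (z : S3) : ∃ v : E3, ‖v‖ ≤ Real.pi ∧ qmap v = z := by
  have h := z.eqn
  set r := Real.arccos z.1.1.re with hr
  have hre : z.1.1.re ^ 2 ≤ 1 := by
    nlinarith [sq_nonneg z.1.1.im, sq_nonneg z.1.2.re, sq_nonneg z.1.2.im]
  have hre' := abs_le.1 ((sq_le_one_iff_abs_le_one _).1 hre)
  have hcos : Real.cos r = z.1.1.re := Real.cos_arccos hre'.1 hre'.2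
  have hr0 : 0 ≤ r := Real.arccos_nonneg _
  have hrpi : r ≤ Real.pi := Real.arccos_le_pi _
  have hsin : 0 ≤ Real.sin r := Real.sin_nonneg_of_nonneg_of_le_pi hr0 hrpi
  set w : E3 := !₂[z.1.1.im, z.1.2.re, z.1.2.im] with hw
  have hwn : ‖w‖ = Real.sin r := by
    rw [← sq_eq_sq₀ (norm_nonneg _) hsin, norm_sq_E3]
    have := Real.sin_sq_add_cos_sq r
    rw [hcos] at this
    simp [hw]
    linarith
  obtain ⟨y, hy1, hy2⟩ : ∃ y : E3, ‖y‖ = 1 ∧ w = Real.sin r • y := by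
    rcases eq_or_ne w 0 with h0 | h0
    · refine ⟨EuclideanSpace.single 0 1, by simp, ?_⟩
      rw [← hwn, h0]; simp
    · refine ⟨‖w‖⁻¹ • w, ?_, ?_⟩
      · rw [norm_smul, norm_inv, norm_norm, inv_mul_cancel₀ (norm_ne_zero_iff.2 h0)]
      · rw [← hwn, smul_smul, mul_inv_cancel₀ (norm_ne_zero_iff.2 h0), one_smul]
  have hn : ‖r • y‖ = r := by rw [norm_smul, hy1, Real.norm_of_nonneg hr0, mul_one]
  have key : ∀ i, Real.sinc r * (r • y) i = w i := by
    intro i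
    rw [hy2, ← sinc_mul r]
    simp [mul_assoc]
  refine ⟨r • y, hn.trans_le hrpi, ?_⟩
  apply Subtype.ext
  simp only [qmap, hn, key, hcos]
  simp [hw]

theorem qmap_inj {x y : E3} (hx : ‖x‖ ≤ Real.pi) (hy : ‖y‖ ≤ Real.pi) (h : qmap x = qmap y) :
    x = y ∨ (‖x‖ = Real.pi ∧ ‖y‖ = Real.pi) := by
  have h' := congrArg Subtype.val h
  simp only [qmap, Prod.mk.injEq, Complex.mk.injEq] at h'
  obtain ⟨⟨h1, h2⟩, h3, h4⟩ := h'
  have hr : ‖x‖ = ‖y‖ := Real.injOn_cos ⟨norm_nonneg _, hx⟩ ⟨norm_nonneg _, hy⟩ h1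
  rcases hx.lt_or_eq with hlt | he
  · left
    have hs : Real.sinc ‖x‖ ≠ 0 := by
      rcases (norm_nonneg x).lt_or_eq with h0 | h0
      · rw [Real.sinc_of_ne_zero h0.ne']
        exact (div_pos (Real.sin_pos_of_pos_of_lt_pi h0 hlt) h0).ne'
      · rw [← h0]; simp
    rw [← hr] at h2 h3 h4
    ext i
    fin_cases i
    · exact mul_left_cancel₀ hs h2
    · exact mul_left_cancel₀ hs h3
    · exact mul_left_cancel₀ hs h4
  · right; exact ⟨he, hr ▸ he⟩

theorem qmap_pi {x : E3} (hx : ‖x‖ = Real.pi) : qmap x = ⟨(-1, 0), by simp⟩ := by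
  have hs : Real.sinc Real.pi = 0 := by
    rw [Real.sinc_of_ne_zero Real.pi_ne_zero]; simp
  apply Subtype.ext
  simp only [qmap, hx, hs, Real.cos_pi, zero_mul]
  apply Prod.ext <;> apply Complex.ext <;> simp

theorem exp_unique {A : Type*} [TopologicalSpace A] [PreconnectedSpace A] {f g : A → ℝ}
    (hf : Continuous f) (hg : Continuous g) (h : ∀ a, Circle.exp (f a) = Circle.exp (g a))
    (a : A) (ha : f a = g a) : f = g :=
  Circle.isCoveringMap_exp.eq_of_comp_eq hf hg (funext h) a ha

instance : PreconnectedSpace S3 := by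
  constructor
  have : (Set.univ : Set S3) = qmap '' Set.univ := by
    ext z
    obtain ⟨v, -, hv⟩ := qmap_surj z
    simp only [Set.mem_univ, Set.image_univ, true_iff]
    exact ⟨v, hv⟩
  rw [this]
  exact isPreconnected_univ.image _ continuous_qmap.continuousOn

theorem exists_log (g : C(S3, Circle)) : ∃ θ : C(S3, ℝ), ∀ z, Circle.exp (θ z) = g z := by
  let h : C(E3, Circle) := g.comp ⟨qmap, continuous_qmap⟩
  obtain ⟨t, ht⟩ : ∃ t : ℝ, Circle.exp t = h 0 := ⟨arg (h 0), by simp⟩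
  obtain ⟨θ, ⟨-, hθ⟩, -⟩ := Circle.isCoveringMap_exp.existsUnique_continuousMap_lifts h 0 t ht
  have hθ' : ∀ v, Circle.exp (θ v) = g (qmap v) := fun v => congrFun hθ v
  have hconst : ∀ x y : E3, ‖x‖ = Real.pi → ‖y‖ = Real.pi → θ x = θ y := by
    intro x y hx hy
    have hpre : IsPreconnected (Metric.sphere (0 : E3) Real.pi) :=
      isPreconnected_sphere (by
        rw [← Module.finrank_eq_rank]
        simp) 0 Real.pi
    have : PreconnectedSpace (Metric.sphere (0 : E3) Real.pi) :=
      isPreconnected_iff_preconnectedSpace.1 hpre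
    have := exp_unique (A := Metric.sphere (0 : E3) Real.pi) (f := fun v => θ v.1)
      (g := fun _ => θ y) (by fun_prop) continuous_const
      (fun a => by
        have ha : ‖a.1‖ = Real.pi := by simp
        rw [hθ', hθ', qmap_pi ha, qmap_pi hy]) ⟨y, by simpa using hy⟩ rfl
    exact congrFun this ⟨x, by simpa using hx⟩
  let qB : C(Metric.closedBall (0 : E3) Real.pi, S3) := ⟨fun v => qmap v.1, continuous_qmap.comp continuous_subtype_val⟩
  have hsurj : Function.Surjective qB := by
    intro z
    obtain ⟨v, hv, hz⟩ := qmap_surj z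
    exact ⟨⟨v, by simpa using hv⟩, hz⟩
  have hq : Topology.IsQuotientMap qB := by
    have : CompactSpace (Metric.closedBall (0 : E3) Real.pi) :=
      isCompact_iff_compactSpace.1 (isCompact_closedBall _ _)
    exact (qB.continuous.isClosedMap).isQuotientMap qB.continuous hsurj
  let θB : C(Metric.closedBall (0 : E3) Real.pi, ℝ) := ⟨fun v => θ v.1, by fun_prop⟩
  have hfac : Function.FactorsThrough θB qB := by
    intro x y hxy
    rcases qmap_inj (mem_closedBall_zero_iff.1 x.2) (mem_closedBall_zero_iff.1 y.2) hxy with h | ⟨h1, h2⟩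
    · exact congrArg θ h
    · exact hconst _ _ h1 h2
  refine ⟨hq.lift θB hfac, fun z => ?_⟩
  obtain ⟨v, rfl⟩ := hsurj z
  have : hq.lift θB hfac (qB v) = θB v := by
    have := congrArg (fun k : C(Metric.closedBall (0 : E3) Real.pi, ℝ) => k v) (hq.lift_comp θB hfac)
    exact this
  rw [this]
  exact hθ' v.1

/-- normalised logarithm -/
noncomputable def Lg (g : C(S3, Circle)) : C(S3, ℝ) :=
  (exists_log g).choose - ContinuousMap.const _ ((exists_log g).choose e3)

theorem Lg_e3 (g : C(S3, Circle)) : Lg g e3 = 0 := by simp [Lg]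

theorem exp_Lg (g : C(S3, Circle)) (z : S3) : Circle.exp (Lg g z) = g z * (g e3)⁻¹ := by
  have h := (exists_log g).choose_spec
  simp only [Lg, ContinuousMap.sub_apply, ContinuousMap.const_apply]
  rw [Circle.exp_sub, h, h, div_eq_mul_inv]

theorem Lg_unique (g : C(S3, Circle)) (θ : C(S3, ℝ))
    (h : ∀ z, Circle.exp (θ z) = g z * (g e3)⁻¹) (h0 : θ e3 = 0) : Lg g = θ := by
  apply DFunLike.coe_injective
  refine exp_unique (Lg g).continuous θ.continuous (fun z => ?_) e3 ?_
  · rw [exp_Lg, h]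
  · rw [Lg_e3, h0]

theorem Lg_mul (g g' : C(S3, Circle)) : Lg (g * g') = Lg g + Lg g' := by
  apply Lg_unique
  · intro z
    simp only [ContinuousMap.add_apply, Circle.exp_add, exp_Lg, ContinuousMap.mul_apply, mul_inv]
    exact mul_mul_mul_comm _ _ _ _
  · simp [Lg_e3]

theorem Lg_const (u : Circle) : Lg (ContinuousMap.const _ u) = 0 := by
  apply Lg_unique
  · intro z; simp
  · simp

theorem Lg_act (g : C(S3, Circle)) (h : ∀ u z, g (act u z) = g z) (u : Circle) (z : S3) :
    Lg g (act u z) = Lg g z := by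
  have hu : Continuous fun z => act u z := continuous_act.comp (by fun_prop : Continuous fun z : S3 => (u, z))
  -- connect along the circle orbit
  obtain ⟨t, rfl⟩ : ∃ t, Circle.exp t = u := ⟨arg u, by simp⟩
  have hc : Continuous fun s : ℝ => act (Circle.exp s) z := by
    have : Continuous fun s : ℝ => (Circle.exp s, z) := by fun_prop
    exact continuous_act.comp this
  have := exp_unique (A := ℝ) (f := fun s => Lg g (act (Circle.exp s) z)) (g := fun _ => Lg g z)
    ((Lg g).continuous.comp hc) continuous_const (fun s => by
      rw [exp_Lg, exp_Lg, h]) 0 (by simp [one_act])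
  exact congrFun this t

theorem Lg_small (ε : ℝ) (hε : 0 < ε) : ∃ δ > 0, ∀ g : C(S3, Circle),
    (∀ z, ‖(g z : ℂ) - 1‖ < δ) → ∀ z, |Lg g z| ≤ ε := by
  have hc : ContinuousAt arg 1 := continuousAt_arg (by simp)
  obtain ⟨δ, hδ, hd⟩ := Metric.continuousAt_iff.1 hc (ε / 2) (by linarith)
  refine ⟨min δ 1, by positivity, fun g hg => ?_⟩
  have hsl : ∀ z, (g z : ℂ) ∈ slitPlane := by
    intro z
    left
    have h1 : |((g z : ℂ) - 1).re| < 1 :=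
      (abs_re_le_norm _).trans_lt ((hg z).trans_le (min_le_right _ _))
    have := (abs_lt.1 h1).1
    simp at this
    linarith
  let θ : C(S3, ℝ) := ⟨fun z => arg (g z) - arg (g e3), by
    refine Continuous.sub ?_ continuous_const
    refine continuous_iff_continuousAt.2 fun z => ?_
    have h1 : Continuous fun z => (g z : ℂ) := by fun_prop
    exact ContinuousAt.comp (f := fun z => (g z : ℂ)) (continuousAt_arg (hsl z)) h1.continuousAt⟩
  have hL : Lg g = θ := by
    apply Lg_unique
    · intro z
      change Circle.exp (arg (g z) - arg (g e3)) = _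
      rw [Circle.exp_sub, Circle.exp_arg, Circle.exp_arg, div_eq_mul_inv]
    · exact sub_self _
  intro z
  rw [hL]
  change |arg (g z) - arg (g e3)| ≤ ε
  have hb : ∀ z, |arg (g z)| < ε / 2 := by
    intro z
    have := hd (x := (g z : ℂ)) (by rw [dist_eq_norm]; exact (hg z).trans_le (min_le_left _ _))
    simpa [Real.dist_eq] using this
  have h1 := abs_lt.1 (hb z)
  have h2 := abs_lt.1 (hb e3)
  rw [abs_le]
  constructor <;> linarith [h1.1, h1.2, h2.1, h2.2]

theorem continuous_Lg : Continuous Lg := by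
  rw [continuous_iff_continuousAt]
  intro g0
  rw [Metric.continuousAt_iff]
  intro ε hε
  obtain ⟨δ, hδ, h⟩ := Lg_small (ε / 2) (by linarith)
  refine ⟨δ, hδ, fun g hg => ?_⟩
  have e1 : g = (g * g0⁻¹) * g0 := by simp
  have e2 : Lg g - Lg g0 = Lg (g * g0⁻¹) := by
    nth_rewrite 1 [e1]
    rw [Lg_mul]; simp
  refine lt_of_le_of_lt ?_ (by linarith : ε / 2 < ε)
  rw [dist_eq_norm, e2, ContinuousMap.norm_le _ (by linarith)]
  refine fun z => h _ (fun z => ?_) z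
  have h1 : dist (g z) (g0 z) < δ := (ContinuousMap.dist_apply_le_dist z).trans_lt hg
  change dist (g z : ℂ) (g0 z : ℂ) < δ at h1
  rw [dist_eq_norm] at h1
  have h2 : ((g * g0⁻¹ : C(S3, Circle)) z : ℂ) - 1 = ((g z : ℂ) - g0 z) * ((g0 z)⁻¹ : Circle) := by
    have : (g0 z : ℂ) * ((g0 z)⁻¹ : Circle) = 1 := by
      rw [← Circle.coe_mul]; simp
    rw [sub_mul, this]; simp
  rw [h2, norm_mul, Circle.norm_coe, mul_one]
  exact h1

end S19

namespace S19
open Complex ComplexConjugate MeasureTheory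

/-- clamp to the unit interval -/
noncomputable def clampI (t : ℝ) : ℝ := max 0 (min t 1)

theorem clampI_nonneg (t : ℝ) : 0 ≤ clampI t := le_max_left _ _
theorem clampI_le (t : ℝ) : clampI t ≤ 1 := max_le zero_le_one (min_le_right _ _)
theorem clampI_of (t : ℝ) (h : t ∈ Set.Ioc (0 : ℝ) 1) : clampI t = t := by
  unfold clampI; rw [min_eq_left h.2, max_eq_right h.1.le]

/-- parametrisation of a slice of the 3-sphere -/
noncomputable def psi (p : ℝ × ℝ) : S3 :=
  ⟨((Real.sqrt (clampI p.1) : ℂ), (Real.sqrt (1 - clampI p.1) : ℂ) * Circle.exp p.2), by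
    simp only [normSq_mul, normSq_ofReal, Circle.normSq_coe, mul_one]
    rw [Real.mul_self_sqrt (clampI_nonneg _), Real.mul_self_sqrt (by linarith [clampI_le p.1])]
    ring⟩

theorem continuous_psi : Continuous psi := by
  have h : Continuous clampI := by unfold clampI; fun_prop
  have h1 : Continuous fun p : ℝ × ℝ => (Real.sqrt (clampI p.1) : ℂ) := by fun_prop
  have h2 : Continuous fun p : ℝ × ℝ => (Real.sqrt (1 - clampI p.1) : ℂ) * Circle.exp p.2 := by
    fun_prop
  exact Continuous.subtype_mk (h1.prodMk h2) _

/-- base measure -/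
noncomputable def mu0 : Measure (ℝ × ℝ) :=
  (volume.restrict (Set.Ioc (0 : ℝ) 1)).prod (volume.restrict (Set.Ioc (0 : ℝ) (2 * Real.pi)))

instance : IsFiniteMeasure mu0 := by unfold mu0; infer_instance

/-- measure on the 3-sphere -/
noncomputable def mu : Measure S3 := mu0.map psi

instance : IsFiniteMeasure mu := by unfold mu; infer_instance

theorem int_mu (φ : C(S3, ℂ)) : ∫ z, φ z ∂mu = ∫ p, φ (psi p) ∂mu0 := by
  unfold mu
  rw [integral_map continuous_psi.measurable.aemeasurable
    φ.continuous.aestronglyMeasurable]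

/-- coordinates -/
def zeta1 : C(S3, ℂ) := ⟨fun z => z.1.1, by fun_prop⟩
/-- coordinates -/
def zeta2 : C(S3, ℂ) := ⟨fun z => z.1.2, by fun_prop⟩

/-- monomials -/
noncomputable def mon (a b : ℕ) : C(S3, ℂ) := zeta1 ^ a * zeta2 ^ b

theorem mon_apply (a b : ℕ) (z : S3) : mon a b z = z.1.1 ^ a * z.1.2 ^ b := rfl

theorem circ_int (b b' : ℕ) (h : b ≠ b') :
    ∫ θ in Set.Ioc (0 : ℝ) (2 * Real.pi),
      ((Circle.exp θ : ℂ) ^ b * conj (Circle.exp θ : ℂ) ^ b') = 0 := by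
  have hc : ((b : ℂ) - b') * I ≠ 0 := by
    refine mul_ne_zero (sub_ne_zero.2 ?_) I_ne_zero
    exact_mod_cast h
  have e : ∀ θ : ℝ, ((Circle.exp θ : ℂ) ^ b * conj (Circle.exp θ : ℂ) ^ b') =
      Complex.exp ((((b : ℂ) - b') * I) * θ) := by
    intro θ
    rw [Circle.coe_exp, ← Complex.exp_conj, ← Complex.exp_nat_mul, ← Complex.exp_nat_mul,
      ← Complex.exp_add]
    congr 1
    simp
    ring
  simp_rw [e]
  rw [← intervalIntegral.integral_of_le (by positivity), integral_exp_mul_complex hc]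
  have : Complex.exp (((b : ℂ) - b') * I * ((2 * Real.pi : ℝ) : ℂ)) = 1 := by
    rw [Complex.exp_eq_one_iff]
    exact ⟨(b : ℤ) - b', by push_cast; ring⟩
  rw [this]; simp

theorem mon_psi (a b a' b' : ℕ) (p : ℝ × ℝ) : mon a b (psi p) * conj (mon a' b' (psi p)) =
    (((Real.sqrt (clampI p.1)) ^ (a + a') * (Real.sqrt (1 - clampI p.1)) ^ (b + b') : ℝ) : ℂ) *
    ((Circle.exp p.2 : ℂ) ^ b * conj (Circle.exp p.2 : ℂ) ^ b') := by
  simp only [mon_apply, psi, map_mul, map_pow, conj_ofReal]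
  push_cast
  ring

theorem mon_orth (a b a' b' : ℕ) (h : b ≠ b') :
    ∫ z, mon a b z * conj (mon a' b' z) ∂mu = 0 := by
  have := int_mu (mon a b * star (mon a' b'))
  simp only [ContinuousMap.mul_apply, ContinuousMap.star_apply] at this
  refine Eq.trans this ?_
  change ∫ p, mon a b (psi p) * conj (mon a' b' (psi p)) ∂mu0 = 0
  simp_rw [mon_psi]
  unfold mu0
  rw [integral_prod_mul (fun t : ℝ => (((Real.sqrt (clampI t)) ^ (a + a') *
    (Real.sqrt (1 - clampI t)) ^ (b + b') : ℝ) : ℂ))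
    (fun θ : ℝ => ((Circle.exp θ : ℂ) ^ b * conj (Circle.exp θ : ℂ) ^ b')), circ_int b b' h, mul_zero]

/-- beta integrals -/
noncomputable def bet (a b : ℕ) : ℝ := ∫ t in (0 : ℝ)..1, t ^ a * (1 - t) ^ b

theorem mon_norm (a b : ℕ) :
    ∫ z, mon a b z * conj (mon a b z) ∂mu = ((2 * Real.pi * bet a b : ℝ) : ℂ) := by
  have := int_mu (mon a b * star (mon a b))
  simp only [ContinuousMap.mul_apply, ContinuousMap.star_apply] at this
  refine Eq.trans this ?_
  change ∫ p, mon a b (psi p) * conj (mon a b (psi p)) ∂mu0 = _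
  simp_rw [mon_psi]
  unfold mu0
  rw [integral_prod_mul (fun t : ℝ => (((Real.sqrt (clampI t)) ^ (a + a) *
    (Real.sqrt (1 - clampI t)) ^ (b + b) : ℝ) : ℂ))
    (fun θ : ℝ => ((Circle.exp θ : ℂ) ^ b * conj (Circle.exp θ : ℂ) ^ b))]
  have e : ∀ θ : ℝ, ((Circle.exp θ : ℂ) ^ b * conj (Circle.exp θ : ℂ) ^ b) = 1 := by
    intro θ
    rw [← mul_pow, mul_conj, Circle.normSq_coe]; simp
  simp_rw [e]
  have h1 : ∫ t in Set.Ioc (0 : ℝ) 1, (((Real.sqrt (clampI t)) ^ (a + a) *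
    (Real.sqrt (1 - clampI t)) ^ (b + b) : ℝ) : ℂ) = (bet a b : ℂ) := by
    unfold bet
    rw [intervalIntegral.integral_of_le zero_le_one, ← integral_complex_ofReal]
    refine setIntegral_congr_fun measurableSet_Ioc fun t ht => ?_
    rw [clampI_of t ht, ← two_mul, ← two_mul, pow_mul, pow_mul, Real.sq_sqrt ht.1.le,
      Real.sq_sqrt (by linarith [ht.2])]
  rw [h1]
  have : (0 : ℝ) ≤ 2 * Real.pi := by positivity
  simp [this]
  ring

theorem bet_zero : bet 0 0 = 1 := by simp [bet]

theorem bet_add (a b : ℕ) : bet a b = bet (a + 1) b + bet a (b + 1) := by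
  unfold bet
  rw [← intervalIntegral.integral_add]
  · congr 1; ext t; ring
  · apply Continuous.intervalIntegrable; fun_prop
  · apply Continuous.intervalIntegrable; fun_prop

theorem bet_parts (a b : ℕ) : ((a : ℝ) + 1) * bet a (b + 1) = (b + 1) * bet (a + 1) b := by
  have h := intervalIntegral.integral_eq_sub_of_hasDerivAt (a := (0 : ℝ)) (b := 1)
    (f := fun t : ℝ => t ^ (a + 1) * (1 - t) ^ (b + 1))
    (f' := fun t : ℝ => ((a : ℝ) + 1) * (t ^ a * (1 - t) ^ (b + 1)) -
      ((b : ℝ) + 1) * (t ^ (a + 1) * (1 - t) ^ b)) ?_ ?_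
  · rw [intervalIntegral.integral_sub, intervalIntegral.integral_const_mul,
      intervalIntegral.integral_const_mul] at h
    · simp at h
      unfold bet; linarith
    · apply Continuous.intervalIntegrable; fun_prop
    · apply Continuous.intervalIntegrable; fun_prop
  · intro t _
    have h1 := (hasDerivAt_pow (a + 1) t)
    have h2 := (((hasDerivAt_id t).const_sub 1).pow (b + 1))
    have h3 := h1.mul h2
    refine h3.congr_deriv ?_
    simp
    ring
  · apply Continuous.intervalIntegrable; fun_prop

theorem bet_succ1 (a b : ℕ) : ((a : ℝ) + b + 2) * bet (a + 1) b = (a + 1) * bet a b := by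
  linear_combination -bet_parts a b - ((a : ℝ) + 1) * bet_add a b

theorem bet_succ2 (a b : ℕ) : ((a : ℝ) + b + 2) * bet a (b + 1) = (b + 1) * bet a b := by
  linear_combination bet_parts a b - ((b : ℝ) + 1) * bet_add a b

theorem bet_pos (a b : ℕ) : 0 < bet a b := by
  induction a with
  | zero =>
    induction b with
    | zero => rw [bet_zero]; norm_num
    | succ b ih =>
      have := bet_succ2 0 b
      have h2 : 0 < ((b : ℝ) + 1) * bet 0 b := by positivity
      rw [← this] at h2
      exact pos_of_mul_pos_right h2 (by positivity)
  | succ a ih =>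
    have := bet_succ1 a b
    have h2 : 0 < ((a : ℝ) + 1) * bet a b := by positivity
    rw [← this] at h2
    exact pos_of_mul_pos_right h2 (by positivity)

end S19

namespace S19
open Complex ComplexConjugate MeasureTheory

/-- the Hilbert space -/
abbrev Hs : Type := Lp ℂ 2 mu

theorem inner_self_c {H : Type*} [NormedAddCommGroup H] [InnerProductSpace ℂ H] (v : H) :
    inner ℂ v v = ((‖v‖ ^ 2 : ℝ) : ℂ) := by
  rw [inner_self_eq_norm_sq_to_K]; push_cast; rfl

/-- embedding of continuous functions -/
noncomputable def J : C(S3, ℂ) →L[ℂ] Hs := ContinuousMap.toLp 2 mu ℂ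

theorem inner_J (φ ψ : C(S3, ℂ)) : inner ℂ (J φ) (J ψ) = ∫ z, ψ z * conj (φ z) ∂mu :=
  ContinuousMap.inner_toLp mu φ ψ

theorem norm_J_sq (φ : C(S3, ℂ)) : ‖J φ‖ ^ 2 = ∫ z, ‖φ z‖ ^ 2 ∂mu := by
  have h := inner_J φ φ
  rw [inner_self_c] at h
  have h2 : ∀ z, φ z * conj (φ z) = ((‖φ z‖ ^ 2 : ℝ) : ℂ) := by
    intro z; rw [mul_conj, normSq_eq_norm_sq]
  simp_rw [h2] at h
  rw [integral_complex_ofReal] at h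
  have h3 : ((‖J φ‖ ^ 2 : ℝ) : ℂ) = ((∫ z, ‖φ z‖ ^ 2 ∂mu : ℝ) : ℂ) := by
    rw [← h]
  exact_mod_cast h3

theorem int_of_cont (φ : S3 → ℝ) (h : Continuous φ) : Integrable φ mu := by
  obtain ⟨C, hC⟩ := isCompact_univ.exists_bound_of_continuousOn (f := φ) h.continuousOn
  exact Integrable.of_bound h.aestronglyMeasurable C (Filter.Eventually.of_forall fun z => hC z trivial)

theorem J_mul_le (φ ψ : C(S3, ℂ)) : ‖J (φ * ψ)‖ ≤ ‖φ‖ * ‖J ψ‖ := by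
  refine (sq_le_sq₀ (norm_nonneg _) (by positivity)).1 ?_
  rw [mul_pow, norm_J_sq, norm_J_sq, ← integral_const_mul]
  refine integral_mono (int_of_cont _ (by fun_prop)) (int_of_cont _ (by fun_prop)) fun z => ?_
  simp only [ContinuousMap.mul_apply, norm_mul, mul_pow]
  gcongr
  exact φ.norm_coe_le_norm z

theorem norm_J_sum (g g' p1 p2 : C(S3, ℂ))
    (h : ∀ z, ‖g z‖ ^ 2 + ‖g' z‖ ^ 2 = ‖p1 z‖ ^ 2 + ‖p2 z‖ ^ 2) :
    ‖J g‖ ^ 2 + ‖J g'‖ ^ 2 = ‖J p1‖ ^ 2 + ‖J p2‖ ^ 2 := by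
  simp only [norm_J_sq]
  rw [← integral_add (int_of_cont _ (by fun_prop)) (int_of_cont _ (by fun_prop)),
    ← integral_add (int_of_cont _ (by fun_prop)) (int_of_cont _ (by fun_prop))]
  simp_rw [h]

theorem inner_star_left (φ ψ χ : C(S3, ℂ)) :
    inner ℂ (J (star φ * ψ)) (J χ) = inner ℂ (J ψ) (J (φ * χ)) := by
  rw [inner_J, inner_J]
  congr 1; ext z
  simp
  ring

theorem inner_star_both (φ ψ χ : C(S3, ℂ)) :
    inner ℂ (J (star φ * ψ)) (J (star φ * χ)) = inner ℂ (J (φ * ψ)) (J (φ * χ)) := by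
  rw [inner_J, inner_J]
  congr 1; ext z
  simp
  ring

theorem inner_mon (a b a' b' : ℕ) (h : b ≠ b') :
    inner ℂ (J (mon a b)) (J (mon a' b')) = 0 := by
  rw [inner_J]; exact mon_orth _ _ _ _ h.symm

theorem norm_mon (a b : ℕ) : ‖J (mon a b)‖ ^ 2 = 2 * Real.pi * bet a b := by
  have h := mon_norm a b
  rw [← inner_J, inner_self_c] at h
  exact_mod_cast h

theorem inner_mon_self (a b : ℕ) :
    inner ℂ (J (mon a b)) (J (mon a b)) = ((2 * Real.pi * bet a b : ℝ) : ℂ) := by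
  rw [inner_J]; exact mon_norm a b

theorem zeta1_mon (a b : ℕ) : zeta1 * mon a b = mon (a + 1) b := by
  unfold mon; ring
theorem zeta2_mon (a b : ℕ) : zeta2 * mon a b = mon a (b + 1) := by
  unfold mon; ring

theorem orth_sum {H : Type*} [NormedAddCommGroup H] [InnerProductSpace ℂ H] (v : ℕ → H)
    (s : Finset ℕ) (h : ∀ a ∈ s, ∀ a' ∈ s, a ≠ a' → inner ℂ (v a) (v a') = 0) (c : ℕ → ℂ) :
    ‖∑ a ∈ s, c a • v a‖ ^ 2 = ∑ a ∈ s, ‖c a‖ ^ 2 * ‖v a‖ ^ 2 := by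
  have h1 : inner ℂ (∑ a ∈ s, c a • v a) (∑ a ∈ s, c a • v a) =
      ∑ a ∈ s, ((‖c a‖ ^ 2 * ‖v a‖ ^ 2 : ℝ) : ℂ) := by
    rw [sum_inner]
    refine Finset.sum_congr rfl fun a ha => ?_
    rw [inner_sum, Finset.sum_eq_single a]
    · rw [inner_smul_left, inner_smul_right, inner_self_c, ← mul_assoc, mul_comm (conj (c a)),
        mul_conj, normSq_eq_norm_sq]
      push_cast; ring
    · intro a' ha' hne
      rw [inner_smul_left, inner_smul_right, h a ha a' ha' hne.symm]; simp
    · intro h; exact absurd ha h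
  rw [inner_self_c] at h1
  exact_mod_cast h1

theorem orth_bound {H : Type*} [NormedAddCommGroup H] [InnerProductSpace ℂ H] (m r : ℕ → H)
    (s : Finset ℕ) (hm : ∀ a ∈ s, ∀ a' ∈ s, a ≠ a' → inner ℂ (m a) (m a') = 0)
    (hr : ∀ a ∈ s, ∀ a' ∈ s, a ≠ a' → inner ℂ (r a) (r a') = 0) (ε : ℝ) (hε : 0 ≤ ε)
    (hb : ∀ a ∈ s, ‖r a‖ ^ 2 ≤ ε ^ 2 * ‖m a‖ ^ 2) (c : ℕ → ℂ) :
    ‖∑ a ∈ s, c a • r a‖ ≤ ε * ‖∑ a ∈ s, c a • m a‖ := by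
  refine (sq_le_sq₀ (norm_nonneg _) (by positivity)).1 ?_
  rw [mul_pow, orth_sum r s hr, orth_sum m s hm, Finset.mul_sum]
  refine Finset.sum_le_sum fun a ha => ?_
  have := mul_le_mul_of_nonneg_left (hb a ha) (sq_nonneg ‖c a‖)
  linarith

end S19

namespace S19
open Complex ComplexConjugate MeasureTheory

/-- lowered monomial -/
noncomputable def low1 (a b : ℕ) : C(S3, ℂ) := (((a : ℝ) / (a + b + 1) : ℝ) : ℂ) • mon (a - 1) b
/-- lowered monomial -/
noncomputable def low2 (a b : ℕ) : C(S3, ℂ) := (((b : ℝ) / (a + b + 1) : ℝ) : ℂ) • mon a (b - 1)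

/-- residual -/
noncomputable def res1 (a b : ℕ) : C(S3, ℂ) := star zeta1 * mon a b - low1 a b
/-- residual -/
noncomputable def res2 (a b : ℕ) : C(S3, ℂ) := star zeta2 * mon a b - low2 a b

theorem inner_x1_low1 (a b a' b' : ℕ) : inner ℂ (J (star zeta1 * mon a b)) (J (low1 a' b')) =
    (((a' : ℝ) / (a' + b' + 1) : ℝ) : ℂ) * inner ℂ (J (mon a b)) (J (mon a' b')) := by
  unfold low1
  rw [map_smul, inner_smul_right, inner_star_left, zeta1_mon]
  rcases a' with _ | a'
  · simp
  · simp

theorem inner_x2_low2 (a b a' b' : ℕ) : inner ℂ (J (star zeta2 * mon a b)) (J (low2 a' b')) =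
    (((b' : ℝ) / (a' + b' + 1) : ℝ) : ℂ) * inner ℂ (J (mon a b)) (J (mon a' b')) := by
  unfold low2
  rw [map_smul, inner_smul_right, inner_star_left, zeta2_mon]
  rcases b' with _ | b'
  · simp
  · simp

theorem inner_low1 (a b a' b' : ℕ) (h : b ≠ b') : inner ℂ (J (low1 a b)) (J (low1 a' b')) = 0 := by
  unfold low1
  rw [map_smul, map_smul, inner_smul_right, inner_smul_left, inner_mon _ _ _ _ h]; simp

theorem inner_low2 (a b a' b' : ℕ) (h : b ≠ b') : inner ℂ (J (low2 a b)) (J (low2 a' b')) = 0 := by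
  rcases b with _ | b
  · simp [low2]
  rcases b' with _ | b'
  · simp [low2]
  unfold low2
  rw [map_smul, map_smul, inner_smul_right, inner_smul_left, inner_mon _ _ _ _ (by simpa using h)]; simp

theorem norm_low1 (a b : ℕ) : ‖J (low1 a b)‖ ^ 2 =
    ((a : ℝ) / (a + b + 1)) * (2 * Real.pi * bet a b) := by
  unfold low1
  rw [map_smul, norm_smul, mul_pow, norm_mon, norm_real, Real.norm_eq_abs, sq_abs]
  rcases a with _ | a
  · simp
  · have := bet_succ1 a b
    have h2 : (a : ℝ) + b + 2 ≠ 0 := by positivity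
    have h3 : (a : ℝ) + 1 + b + 1 = a + b + 2 := by ring
    simp only [Nat.cast_add, Nat.cast_one, Nat.add_sub_cancel]
    rw [h3]
    field_simp
    linarith

theorem norm_low2 (a b : ℕ) : ‖J (low2 a b)‖ ^ 2 =
    ((b : ℝ) / (a + b + 1)) * (2 * Real.pi * bet a b) := by
  unfold low2
  rw [map_smul, norm_smul, mul_pow, norm_mon, norm_real, Real.norm_eq_abs, sq_abs]
  rcases b with _ | b
  · simp
  · have := bet_succ2 a b
    have h2 : (a : ℝ) + b + 2 ≠ 0 := by positivity
    have h3 : (a : ℝ) + (b + 1) + 1 = a + b + 2 := by ring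
    simp only [Nat.cast_add, Nat.cast_one, Nat.add_sub_cancel]
    rw [h3]
    field_simp
    linarith

theorem norm_x1 (a b : ℕ) : ‖J (star zeta1 * mon a b)‖ ^ 2 = 2 * Real.pi * bet (a + 1) b := by
  have h := inner_star_both zeta1 (mon a b) (mon a b)
  rw [zeta1_mon, inner_self_c, inner_self_c, norm_mon] at h
  exact_mod_cast h

theorem norm_x2 (a b : ℕ) : ‖J (star zeta2 * mon a b)‖ ^ 2 = 2 * Real.pi * bet a (b + 1) := by
  have h := inner_star_both zeta2 (mon a b) (mon a b)
  rw [zeta2_mon, inner_self_c, inner_self_c, norm_mon] at h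
  exact_mod_cast h

theorem res1_norm (a b : ℕ) :
    ‖J (res1 a b)‖ ^ 2 ≤ 1 / ((a : ℝ) + b + 2) * ‖J (mon a b)‖ ^ 2 := by
  unfold res1
  rw [map_sub, @norm_sub_sq ℂ, norm_x1, norm_low1, inner_x1_low1, inner_mon_self, norm_mon]
  rw [← ofReal_mul]
  have hre : ∀ x : ℝ, RCLike.re ((x : ℝ) : ℂ) = x := fun x => Complex.ofReal_re x
  rw [hre]
  have h1 := bet_succ1 a b
  have h2 : 0 < (a : ℝ) + b + 2 := by positivity
  have h2' : 0 < (a : ℝ) + b + 1 := by positivity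
  have h3 : bet (a + 1) b = (a + 1) / (a + b + 2) * bet a b := by
    field_simp; linarith
  rw [h3]
  have h4 : ((a : ℝ) + 1) / (a + b + 2) - a / (a + b + 1) ≤ 1 / (a + b + 2) := by
    have : ((a : ℝ)) / (a + b + 2) ≤ a / (a + b + 1) := by gcongr; linarith
    rw [add_div]; linarith
  have h5 : 0 ≤ 2 * Real.pi * bet a b := by have := bet_pos a b; positivity
  have := mul_le_mul_of_nonneg_right h4 h5
  linarith

theorem res2_norm (a b : ℕ) :
    ‖J (res2 a b)‖ ^ 2 ≤ 1 / ((a : ℝ) + b + 2) * ‖J (mon a b)‖ ^ 2 := by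
  unfold res2
  rw [map_sub, @norm_sub_sq ℂ, norm_x2, norm_low2, inner_x2_low2, inner_mon_self, norm_mon]
  rw [← ofReal_mul]
  have hre : ∀ x : ℝ, RCLike.re ((x : ℝ) : ℂ) = x := fun x => Complex.ofReal_re x
  rw [hre]
  have h1 := bet_succ2 a b
  have h2 : 0 < (a : ℝ) + b + 2 := by positivity
  have h2' : 0 < (a : ℝ) + b + 1 := by positivity
  have h3 : bet a (b + 1) = (b + 1) / (a + b + 2) * bet a b := by
    field_simp; linarith
  rw [h3]
  have h4 : ((b : ℝ) + 1) / (a + b + 2) - b / (a + b + 1) ≤ 1 / (a + b + 2) := by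
    have : ((b : ℝ)) / (a + b + 2) ≤ b / (a + b + 1) := by gcongr; linarith
    rw [add_div]; linarith
  have h5 : 0 ≤ 2 * Real.pi * bet a b := by have := bet_pos a b; positivity
  have := mul_le_mul_of_nonneg_right h4 h5
  linarith

theorem res1_orth (a b a' b' : ℕ) (h : b ≠ b') : inner ℂ (J (res1 a b)) (J (res1 a' b')) = 0 := by
  unfold res1
  rw [map_sub, map_sub, inner_sub_left, inner_sub_right, inner_sub_right, inner_low1 _ _ _ _ h,
    inner_x1_low1, inner_mon _ _ _ _ h, inner_star_both, zeta1_mon, zeta1_mon, inner_mon _ _ _ _ h,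
    ← inner_conj_symm, inner_x1_low1, inner_mon _ _ _ _ h.symm]
  simp

theorem res2_orth (a b a' b' : ℕ) (h : b ≠ b') : inner ℂ (J (res2 a b)) (J (res2 a' b')) = 0 := by
  unfold res2
  rw [map_sub, map_sub, inner_sub_left, inner_sub_right, inner_sub_right, inner_low2 _ _ _ _ h,
    inner_x2_low2, inner_mon _ _ _ _ h, inner_star_both, zeta2_mon, zeta2_mon,
    inner_mon _ _ _ _ (by simpa using h),
    ← inner_conj_symm, inner_x2_low2, inner_mon _ _ _ _ h.symm]
  simp

/-- homogeneous polynomials -/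
noncomputable def Pn (n : ℤ) : Submodule ℂ C(S3, ℂ) :=
  Submodule.span ℂ {φ | ∃ a b : ℕ, ((a : ℤ) + b = n) ∧ φ = mon a b}

theorem mon_mem (a b : ℕ) (n : ℤ) (h : (a : ℤ) + b = n) : mon a b ∈ Pn n :=
  Submodule.subset_span ⟨a, b, h, rfl⟩

theorem Pn_repr (n : ℕ) (p : C(S3, ℂ)) (hp : p ∈ Pn n) :
    ∃ c : ℕ → ℂ, p = ∑ a ∈ Finset.range (n + 1), c a • mon a (n - a) := by
  induction hp using Submodule.span_induction with
  | mem x h =>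
    obtain ⟨a, b, h, rfl⟩ := h
    refine ⟨Pi.single a 1, ?_⟩
    rw [Finset.sum_eq_single a]
    · have : n - a = b := by omega
      simp [this]
    · intro a' _ h'
      simp [Pi.single_apply, h']
    · intro h'; simp at h'; omega
  | zero => exact ⟨0, by simp⟩
  | add x y _ _ hx hy =>
    obtain ⟨c, hc⟩ := hx
    obtain ⟨d, hd⟩ := hy
    refine ⟨c + d, ?_⟩
    rw [hc, hd, ← Finset.sum_add_distrib]
    simp [add_smul]
  | smul t x _ hx =>
    obtain ⟨c, hc⟩ := hx
    refine ⟨t • c, ?_⟩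
    rw [hc, Finset.smul_sum]
    simp [smul_smul]

theorem zeta1_mul_mem {n : ℤ} {p : C(S3, ℂ)} (hp : p ∈ Pn n) : zeta1 * p ∈ Pn (n + 1) := by
  induction hp using Submodule.span_induction with
  | mem x h =>
    obtain ⟨a, b, h, rfl⟩ := h
    rw [zeta1_mon]
    exact mon_mem _ _ _ (by push_cast; linarith)
  | zero => simp
  | add x y _ _ hx hy => rw [mul_add]; exact add_mem hx hy
  | smul t x _ hx => rw [mul_smul_comm]; exact Submodule.smul_mem _ _ hx

theorem zeta2_mul_mem {n : ℤ} {p : C(S3, ℂ)} (hp : p ∈ Pn n) : zeta2 * p ∈ Pn (n + 1) := by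
  induction hp using Submodule.span_induction with
  | mem x h =>
    obtain ⟨a, b, h, rfl⟩ := h
    rw [zeta2_mon]
    exact mon_mem _ _ _ (by push_cast; linarith)
  | zero => simp
  | add x y _ _ hx hy => rw [mul_add]; exact add_mem hx hy
  | smul t x _ hx => rw [mul_smul_comm]; exact Submodule.smul_mem _ _ hx

theorem low1_mem (a b : ℕ) (n : ℤ) (h : (a : ℤ) + b = n) : low1 a b ∈ Pn (n + -1) := by
  rcases a with _ | a
  · simp [low1]
  · exact Submodule.smul_mem _ _ (mon_mem _ _ _ (by push_cast at h ⊢; linarith))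

theorem low2_mem (a b : ℕ) (n : ℤ) (h : (a : ℤ) + b = n) : low2 a b ∈ Pn (n + -1) := by
  rcases b with _ | b
  · simp [low2]
  · exact Submodule.smul_mem _ _ (mon_mem _ _ _ (by push_cast at h ⊢; linarith))

/-- `φ` almost maps `Pn N` to `Pn (N + k)` -/
def Ad (k : ℤ) (φ : C(S3, ℂ)) : Prop :=
  ∀ ε > 0, ∃ N0 : ℤ, ∀ N ≥ N0, ∀ p ∈ Pn N, ∃ q ∈ Pn (N + k), ‖J (φ * p) - J q‖ ≤ ε * ‖J p‖

theorem Ad_zeta1 : Ad 1 zeta1 := fun ε hε => ⟨0, fun N _ p hp =>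
  ⟨_, zeta1_mul_mem hp, by simp; positivity⟩⟩

theorem Ad_zeta2 : Ad 1 zeta2 := fun ε hε => ⟨0, fun N _ p hp =>
  ⟨_, zeta2_mul_mem hp, by simp; positivity⟩⟩

theorem small_aux (ε : ℝ) (hε : 0 < ε) : ∃ N0 : ℤ, 0 ≤ N0 ∧ ∀ n : ℕ, N0 ≤ n → 1 / ((n : ℝ) + 2) ≤ ε ^ 2 := by
  obtain ⟨m, hm⟩ := exists_nat_gt (1 / ε ^ 2)
  refine ⟨m, by positivity, fun n hn => ?_⟩
  have hn' : (m : ℝ) ≤ n := by exact_mod_cast hn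
  rw [div_le_iff₀ (by positivity)]
  rw [div_lt_iff₀ (by positivity)] at hm
  nlinarith [sq_pos_of_pos hε]

theorem Ad_star1 : Ad (-1) (star zeta1) := by
  intro ε hε
  obtain ⟨N0, h0, hN⟩ := small_aux ε hε
  refine ⟨N0, fun N hNN p hp => ?_⟩
  lift N to ℕ using h0.trans hNN with n
  obtain ⟨c, rfl⟩ := Pn_repr n p hp
  have hsub : ∀ a ∈ Finset.range (n + 1), (a : ℤ) + (n - a : ℕ) = n := by
    intro a ha; simp at ha; omega
  refine ⟨∑ a ∈ Finset.range (n + 1), c a • low1 a (n - a), ?_, ?_⟩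
  · exact Submodule.sum_mem _ fun a ha => Submodule.smul_mem _ _ (low1_mem _ _ _ (hsub a ha))
  · have e : J (star zeta1 * ∑ a ∈ Finset.range (n + 1), c a • mon a (n - a)) -
        J (∑ a ∈ Finset.range (n + 1), c a • low1 a (n - a)) =
        ∑ a ∈ Finset.range (n + 1), c a • J (res1 a (n - a)) := by
      rw [← map_sub, Finset.mul_sum, ← Finset.sum_sub_distrib, map_sum]
      refine Finset.sum_congr rfl fun a _ => ?_
      rw [mul_smul_comm, ← smul_sub, map_smul]; rfl
    rw [e, map_sum]
    simp_rw [map_smul]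
    refine orth_bound _ _ _ (fun a ha a' ha' hne => inner_mon _ _ _ _ ?_)
      (fun a ha a' ha' hne => res1_orth _ _ _ _ ?_) ε hε.le (fun a ha => ?_) c
    · simp at ha ha'; omega
    · simp at ha ha'; omega
    · refine (res1_norm _ _).trans ?_
      have h1 : (a : ℝ) + (n - a : ℕ) = n := by exact_mod_cast hsub a ha
      rw [h1]
      gcongr
      exact hN n hNN

theorem Ad_star2 : Ad (-1) (star zeta2) := by
  intro ε hε
  obtain ⟨N0, h0, hN⟩ := small_aux ε hε
  refine ⟨N0, fun N hNN p hp => ?_⟩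
  lift N to ℕ using h0.trans hNN with n
  obtain ⟨c, rfl⟩ := Pn_repr n p hp
  have hsub : ∀ a ∈ Finset.range (n + 1), (a : ℤ) + (n - a : ℕ) = n := by
    intro a ha; simp at ha; omega
  refine ⟨∑ a ∈ Finset.range (n + 1), c a • low2 a (n - a), ?_, ?_⟩
  · exact Submodule.sum_mem _ fun a ha => Submodule.smul_mem _ _ (low2_mem _ _ _ (hsub a ha))
  · have e : J (star zeta2 * ∑ a ∈ Finset.range (n + 1), c a • mon a (n - a)) -
        J (∑ a ∈ Finset.range (n + 1), c a • low2 a (n - a)) =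
        ∑ a ∈ Finset.range (n + 1), c a • J (res2 a (n - a)) := by
      rw [← map_sub, Finset.mul_sum, ← Finset.sum_sub_distrib, map_sum]
      refine Finset.sum_congr rfl fun a _ => ?_
      rw [mul_smul_comm, ← smul_sub, map_smul]; rfl
    rw [e, map_sum]
    simp_rw [map_smul]
    refine orth_bound _ _ _ (fun a ha a' ha' hne => inner_mon _ _ _ _ ?_)
      (fun a ha a' ha' hne => res2_orth _ _ _ _ ?_) ε hε.le (fun a ha => ?_) c
    · simp at ha ha'; omega
    · simp at ha ha'; omega
    · refine (res2_norm _ _).trans ?_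
      have h1 : (a : ℝ) + (n - a : ℕ) = n := by exact_mod_cast hsub a ha
      rw [h1]
      gcongr
      exact hN n hNN

theorem Ad.add {k : ℤ} {φ ψ : C(S3, ℂ)} (h1 : Ad k φ) (h2 : Ad k ψ) : Ad k (φ + ψ) := by
  intro ε hε
  obtain ⟨N1, h1⟩ := h1 (ε / 2) (by linarith)
  obtain ⟨N2, h2⟩ := h2 (ε / 2) (by linarith)
  refine ⟨max N1 N2, fun N hN p hp => ?_⟩
  obtain ⟨q1, hq1, e1⟩ := h1 N ((le_max_left _ _).trans hN) p hp
  obtain ⟨q2, hq2, e2⟩ := h2 N ((le_max_right _ _).trans hN) p hp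
  refine ⟨q1 + q2, add_mem hq1 hq2, ?_⟩
  have : J ((φ + ψ) * p) - J (q1 + q2) = (J (φ * p) - J q1) + (J (ψ * p) - J q2) := by
    rw [add_mul, map_add, map_add]; abel
  rw [this]
  refine (norm_add_le _ _).trans ?_
  linarith

theorem Ad.mul {k l : ℤ} {φ ψ : C(S3, ℂ)} (h1 : Ad k φ) (h2 : Ad l ψ) : Ad (l + k) (φ * ψ) := by
  intro ε hε
  set C := ‖φ‖ + ‖ψ‖ + 1 with hC
  have hCp : 1 ≤ C := by have := norm_nonneg φ; have := norm_nonneg ψ; linarith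
  obtain ⟨δ, hδ, hδ1, hδ2⟩ : ∃ δ > 0, δ ≤ 1 ∧ δ * C ≤ ε := by
    refine ⟨min 1 (ε / C), by positivity, min_le_left _ _, ?_⟩
    calc min 1 (ε / C) * C ≤ ε / C * C := by gcongr; exact min_le_right _ _
      _ = ε := by field_simp
  obtain ⟨N1, h1⟩ := h1 δ hδ
  obtain ⟨N2, h2⟩ := h2 δ hδ
  refine ⟨max (N1 - l) N2, fun N hN p hp => ?_⟩
  obtain ⟨q, hq, e2⟩ := h2 N ((le_max_right _ _).trans hN) p hp
  obtain ⟨q', hq', e1⟩ := h1 (N + l) (by have := (le_max_left _ _).trans hN; linarith) q hq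
  refine ⟨q', by rwa [← add_assoc], ?_⟩
  have e : J (φ * ψ * p) - J q' = J (φ * (ψ * p - q)) + (J (φ * q) - J q') := by
    rw [mul_sub, map_sub, mul_assoc]; abel
  have h3 : ‖J (φ * (ψ * p - q))‖ ≤ ‖φ‖ * (δ * ‖J p‖) := by
    refine (J_mul_le _ _).trans ?_
    rw [map_sub]; gcongr
  have h4 : ‖J q‖ ≤ (‖ψ‖ + 1) * ‖J p‖ := by
    have h5 : J q = J (ψ * p) - (J (ψ * p) - J q) := by abel
    rw [h5]
    refine (norm_sub_le _ _).trans ?_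
    have := J_mul_le ψ p
    nlinarith [norm_nonneg (J p)]
  rw [e]
  refine (norm_add_le _ _).trans ?_
  calc _ ≤ ‖φ‖ * (δ * ‖J p‖) + δ * ((‖ψ‖ + 1) * ‖J p‖) := by
        refine add_le_add h3 (e1.trans ?_)
        gcongr
    _ = (δ * C) * ‖J p‖ := by rw [hC]; ring
    _ ≤ ε * ‖J p‖ := by gcongr

theorem Ad_const (c : ℂ) : Ad 0 (ContinuousMap.const _ c) := by
  intro ε hε
  refine ⟨0, fun N _ p hp => ⟨c • p, ?_, ?_⟩⟩
  · rw [add_zero]; exact Submodule.smul_mem _ _ hp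
  · have : ContinuousMap.const _ c * p = c • p := by ext z; simp
    rw [this, sub_self, norm_zero]; positivity

theorem Ad_closed {k : ℤ} {φ : C(S3, ℂ)} (h : ∀ ε > 0, ∃ ψ, Ad k ψ ∧ ‖φ - ψ‖ ≤ ε) : Ad k φ := by
  intro ε hε
  obtain ⟨ψ, hψ, hd⟩ := h (ε / 2) (by linarith)
  obtain ⟨N0, h0⟩ := hψ (ε / 2) (by linarith)
  refine ⟨N0, fun N hN p hp => ?_⟩
  obtain ⟨q, hq, e⟩ := h0 N hN p hp
  refine ⟨q, hq, ?_⟩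
  have e2 : J (φ * p) - J q = J ((φ - ψ) * p) + (J (ψ * p) - J q) := by
    rw [sub_mul, map_sub]; abel
  rw [e2]
  refine (norm_add_le _ _).trans ?_
  have h3 := J_mul_le (φ - ψ) p
  have h4 : ‖φ - ψ‖ * ‖J p‖ ≤ ε / 2 * ‖J p‖ := by gcongr
  linarith

theorem Ad.smul {k : ℤ} {φ : C(S3, ℂ)} (c : ℂ) (h : Ad k φ) : Ad k (ContinuousMap.const _ c * φ) := by
  have := (Ad_const c).mul h
  rwa [add_zero] at this

end S19

namespace S19
open Complex ComplexConjugate MeasureTheory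

/-- pull back a real function along the Hopf map -/
noncomputable def pullR (φ : C(Sph2, ℝ)) : C(S3, ℂ) :=
  ⟨fun z => ((φ (hopf z) : ℝ) : ℂ), by have := continuous_hopf; fun_prop⟩

theorem pullR_apply (φ : C(Sph2, ℝ)) (z : S3) : pullR φ z = ((φ (hopf z) : ℝ) : ℂ) := rfl

/-- the good subalgebra -/
noncomputable def goodA : Subalgebra ℝ C(Sph2, ℝ) where
  carrier := {φ | Ad 0 (pullR φ)}
  mul_mem' := by
    intro a b ha hb
    have := Ad.mul ha hb
    rw [add_zero] at this
    have e : pullR (a * b) = pullR a * pullR b := by ext z; simp [pullR_apply]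
    change Ad 0 _
    rwa [e]
  add_mem' := by
    intro a b ha hb
    have e : pullR (a + b) = pullR a + pullR b := by ext z; simp [pullR_apply]
    change Ad 0 _
    rw [e]; exact Ad.add ha hb
  algebraMap_mem' := by
    intro r
    have e : pullR (algebraMap ℝ _ r) = ContinuousMap.const _ (r : ℂ) := by
      ext z; simp [pullR_apply]
    change Ad 0 _
    rw [e]; exact Ad_const _

theorem mem_goodA (φ : C(Sph2, ℝ)) : φ ∈ goodA ↔ Ad 0 (pullR φ) := Iff.rfl

/-- coordinates on the 2-sphere -/
noncomputable def coord (i : Fin 3) : C(Sph2, ℝ) := ⟨fun x => x.1 i, by fun_prop⟩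

theorem coord_mem (i : Fin 3) : coord i ∈ goodA := by
  rw [mem_goodA]
  have h12 : Ad 0 (zeta1 * star zeta2) := by
    have h := Ad.mul Ad_zeta1 Ad_star2
    norm_num at h; exact h
  have h21 : Ad 0 (star zeta1 * zeta2) := by
    have h := Ad.mul Ad_star1 Ad_zeta2
    norm_num at h; exact h
  have h11 : Ad 0 (zeta1 * star zeta1) := by
    have h := Ad.mul Ad_zeta1 Ad_star1
    norm_num at h; exact h
  have h22 : Ad 0 (zeta2 * star zeta2) := by
    have h := Ad.mul Ad_zeta2 Ad_star2
    norm_num at h; exact h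
  fin_cases i
  · have e : pullR (coord 0) = star zeta1 * zeta2 + zeta1 * star zeta2 := by
      ext z
      change ((hopfv z.1 0 : ℝ) : ℂ) = conj z.1.1 * z.1.2 + z.1.1 * conj z.1.2
      rw [hopfv0]
      apply Complex.ext <;> simp <;> ring
    exact e ▸ h21.add h12
  · have e : pullR (coord 1) = ContinuousMap.const _ (-I) * (star zeta1 * zeta2) +
        ContinuousMap.const _ I * (zeta1 * star zeta2) := by
      ext z
      change ((hopfv z.1 1 : ℝ) : ℂ) = -I * (conj z.1.1 * z.1.2) + I * (z.1.1 * conj z.1.2)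
      rw [hopfv1]
      apply Complex.ext <;> simp <;> ring
    exact e ▸ (h21.smul _).add (h12.smul _)
  · have e : pullR (coord 2) = zeta1 * star zeta1 +
        ContinuousMap.const _ (-1) * (zeta2 * star zeta2) := by
      ext z
      change ((hopfv z.1 2 : ℝ) : ℂ) = z.1.1 * conj z.1.1 + -1 * (z.1.2 * conj z.1.2)
      rw [hopfv2, mul_conj, mul_conj]
      push_cast; ring
    exact e ▸ h11.add (h22.smul _)

theorem Ad_pullR (φ : C(Sph2, ℝ)) : Ad 0 (pullR φ) := by
  have hsep : goodA.SeparatesPoints := by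
    intro x y hxy
    by_contra hcon
    push Not at hcon
    apply hxy
    apply Subtype.ext
    ext i
    exact hcon (coord i) ⟨coord i, coord_mem i, rfl⟩
  have h := ContinuousMap.subalgebra_topologicalClosure_eq_top_of_separatesPoints goodA hsep
  have hφ : φ ∈ closure (goodA : Set C(Sph2, ℝ)) := by
    rw [← Subalgebra.topologicalClosure_coe, h]; trivial
  refine Ad_closed fun ε hε => ?_
  obtain ⟨ψ, hψ, hd⟩ := Metric.mem_closure_iff.1 hφ ε hε
  refine ⟨pullR ψ, hψ, ?_⟩
  rw [ContinuousMap.norm_le _ hε.le]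
  intro z
  have h2 : pullR φ z - pullR ψ z = ((φ (hopf z) - ψ (hopf z) : ℝ) : ℂ) := by
    simp [pullR_apply]
  rw [ContinuousMap.sub_apply, h2, norm_real, ← dist_eq_norm]
  exact (ContinuousMap.dist_apply_le_dist _).trans hd.le

theorem Ad_inv (φ : C(S3, ℂ)) (h : ∀ u z, φ (act u z) = φ z) : Ad 0 φ := by
  have key : ∀ z z', hopf z = hopf z' → φ z = φ z' := by
    intro z z' hz
    rw [← act_ratio z z' hz, h]
  obtain ⟨re, hre⟩ : ∃ r : C(Sph2, ℝ), ∀ z, r (hopf z) = (φ z).re :=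
    ⟨hopf_quot.lift ⟨fun z => (φ z).re, by fun_prop⟩ fun z z' hz => by simp [key z z' hz],
      fun z => congrFun (congrArg DFunLike.coe (hopf_quot.lift_comp (f := ⟨hopf, continuous_hopf⟩)
        ⟨fun z => (φ z).re, by fun_prop⟩ fun z z' hz => by simp [key z z' hz])) z⟩
  obtain ⟨im, him⟩ : ∃ r : C(Sph2, ℝ), ∀ z, r (hopf z) = (φ z).im :=
    ⟨hopf_quot.lift ⟨fun z => (φ z).im, by fun_prop⟩ fun z z' hz => by simp [key z z' hz],
      fun z => congrFun (congrArg DFunLike.coe (hopf_quot.lift_comp (f := ⟨hopf, continuous_hopf⟩)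
        ⟨fun z => (φ z).im, by fun_prop⟩ fun z z' hz => by simp [key z z' hz])) z⟩
  have e : φ = pullR re + ContinuousMap.const _ I * pullR im := by
    ext z
    simp only [ContinuousMap.add_apply, ContinuousMap.mul_apply, pullR_apply, hre, him,
      ContinuousMap.const_apply]
    rw [mul_comm]; exact (re_add_im _).symm
  rw [e]
  exact (Ad_pullR _).add ((Ad_pullR _).smul _)

/-- equivariant self-maps -/
def Eqv (F : C(S3, S3)) : Prop := ∀ u z, F (act u z) = act u (F z)

/-- first component -/
noncomputable def c1 (F : C(S3, S3)) : C(S3, ℂ) := zeta1.comp F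
/-- second component -/
noncomputable def c2 (F : C(S3, S3)) : C(S3, ℂ) := zeta2.comp F

theorem c1_apply (F : C(S3, S3)) (z : S3) : c1 F z = (F z).1.1 := rfl
theorem c2_apply (F : C(S3, S3)) (z : S3) : c2 F z = (F z).1.2 := rfl

theorem zeta_sum : zeta1 * star zeta1 + zeta2 * star zeta2 = 1 := by
  ext z; exact mul_conj_add z

theorem circ_conj (u : Circle) : (u : ℂ) * conj (u : ℂ) = 1 := by
  rw [mul_conj, Circle.normSq_coe]; simp

theorem Ad_one_of (φ : C(S3, ℂ)) (h : ∀ u z, φ (act u z) = u * φ z) : Ad 1 φ := by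
  have e : φ = (φ * star zeta1) * zeta1 + (φ * star zeta2) * zeta2 := by
    calc φ = φ * (zeta1 * star zeta1 + zeta2 * star zeta2) := by rw [zeta_sum, mul_one]
      _ = _ := by ring
  have h1 : Ad 0 (φ * star zeta1) := Ad_inv _ fun u z => by
    change φ _ * conj ((u : ℂ) * z.1.1) = φ z * conj z.1.1
    rw [h, map_mul]
    linear_combination (φ z * conj z.1.1) * circ_conj u
  have h2 : Ad 0 (φ * star zeta2) := Ad_inv _ fun u z => by
    change φ _ * conj ((u : ℂ) * z.1.2) = φ z * conj z.1.2
    rw [h, map_mul]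
    linear_combination (φ z * conj z.1.2) * circ_conj u
  rw [e]
  exact (h1.mul Ad_zeta1).add (h2.mul Ad_zeta2)

theorem Ad_neg_of (φ : C(S3, ℂ)) (h : ∀ u z, φ (act u z) = u * φ z) : Ad (-1) (star φ) := by
  have e : star φ = (star φ * zeta1) * star zeta1 + (star φ * zeta2) * star zeta2 := by
    calc star φ = star φ * (zeta1 * star zeta1 + zeta2 * star zeta2) := by rw [zeta_sum, mul_one]
      _ = _ := by ring
  have h1 : Ad 0 (star φ * zeta1) := Ad_inv _ fun u z => by
    change conj (φ _) * ((u : ℂ) * z.1.1) = conj (φ z) * z.1.1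
    rw [h, map_mul]
    linear_combination (conj (φ z) * z.1.1) * circ_conj u
  have h2 : Ad 0 (star φ * zeta2) := Ad_inv _ fun u z => by
    change conj (φ _) * ((u : ℂ) * z.1.2) = conj (φ z) * z.1.2
    rw [h, map_mul]
    linear_combination (conj (φ z) * z.1.2) * circ_conj u
  rw [e]
  exact (h1.mul Ad_star1).add (h2.mul Ad_star2)

theorem Eqv.c1 {F : C(S3, S3)} (h : Eqv F) (u : Circle) (z : S3) : c1 F (act u z) = u * c1 F z := by
  rw [c1_apply, c1_apply, h]; rfl
theorem Eqv.c2 {F : C(S3, S3)} (h : Eqv F) (u : Circle) (z : S3) : c2 F (act u z) = u * c2 F z := by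
  rw [c2_apply, c2_apply, h]; rfl

end S19

namespace S19
open Complex ComplexConjugate MeasureTheory

theorem continuous_c1 : Continuous c1 := ContinuousMap.continuous_postcomp _
theorem continuous_c2 : Continuous c2 := ContinuousMap.continuous_postcomp _

/-- symbol of the upper block -/
noncomputable def up (F : C(S3, S3)) (k : Fin 2) : C(S3, ℂ) := if k = 0 then c1 F else c2 F
/-- symbol of the lower block -/
noncomputable def lo (F : C(S3, S3)) (k : Fin 2) : C(S3, ℂ) :=
  if k = 0 then star (c2 F) else -star (c1 F)

theorem continuous_up (k : Fin 2) : Continuous fun F => up F k := by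
  unfold up; split_ifs
  · exact continuous_c1
  · exact continuous_c2

theorem continuous_lo (k : Fin 2) : Continuous fun F => lo F k := by
  unfold lo; split_ifs
  · exact continuous_c2.star
  · exact continuous_c1.star.neg

/-- the compressed multiplication matrix -/
noncomputable def rowM (N : ℕ) (F : C(S3, S3)) :
    Matrix (Fin (N + 3) ⊕ Fin (N + 1)) (Fin 2 × Fin (N + 2)) ℂ := fun i j =>
  Sum.elim (fun a : Fin (N + 3) => inner ℂ (J (mon a (N + 2 - a))) (J (up F j.1 * mon j.2 (N + 1 - j.2))))
    (fun a : Fin (N + 1) => inner ℂ (J (mon a (N - a))) (J (lo F j.1 * mon j.2 (N + 1 - j.2)))) i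

/-- index identification -/
noncomputable def ee (N : ℕ) : Fin (N + 3) ⊕ Fin (N + 1) ≃ Fin 2 × Fin (N + 2) :=
  Fintype.equivOfCardEq (by simp; omega)

/-- determinant of the compression -/
noncomputable def DM (N : ℕ) (F : C(S3, S3)) : ℂ := ((rowM N F).submatrix (ee N).symm id).det

theorem continuous_DM (N : ℕ) : Continuous (DM N) := by
  unfold DM
  refine Continuous.matrix_det ?_
  refine continuous_matrix fun i j => ?_
  simp only [Matrix.submatrix_apply, id]
  rcases (ee N).symm i with a | a
  · simp only [rowM, Sum.elim_inl]
    have := continuous_up j.1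
    exact continuous_const.inner (J.continuous.comp (this.mul continuous_const))
  · simp only [rowM, Sum.elim_inr]
    have := continuous_lo j.1
    exact continuous_const.inner (J.continuous.comp (this.mul continuous_const))

/-- approximability of multiplication -/
def Gd (N : ℕ) (ε : ℝ) (F : C(S3, S3)) : Prop :=
  ∀ k, (∀ p ∈ Pn (N + 1 : ℕ), ∃ q ∈ Pn (N + 2 : ℕ), ‖J (up F k * p) - J q‖ ≤ ε * ‖J p‖) ∧
    (∀ p ∈ Pn (N + 1 : ℕ), ∃ q ∈ Pn (N : ℕ), ‖J (lo F k * p) - J q‖ ≤ ε * ‖J p‖)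

theorem Gd_of_Eqv {F : C(S3, S3)} (h : Eqv F) (ε : ℝ) (hε : 0 < ε) : ∃ N0 : ℕ, ∀ N ≥ N0, Gd N ε F := by
  have hup : ∀ k, Ad 1 (up F k) := by
    intro k; unfold up; split_ifs
    · exact Ad_one_of _ h.c1
    · exact Ad_one_of _ h.c2
  have hlo : ∀ k, Ad (-1) (lo F k) := by
    intro k; unfold lo; split_ifs
    · exact Ad_neg_of _ h.c2
    · have := (Ad_neg_of _ h.c1).smul (-1)
      convert this using 1
      ext z; simp
  have key : ∀ k, ∃ N0 : ℤ, ∀ N ≥ N0, (∀ p ∈ Pn N, ∃ q ∈ Pn (N + 1), ‖J (up F k * p) - J q‖ ≤ ε * ‖J p‖) ∧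
      (∀ p ∈ Pn N, ∃ q ∈ Pn (N + -1), ‖J (lo F k * p) - J q‖ ≤ ε * ‖J p‖) := by
    intro k
    obtain ⟨N1, h1⟩ := hup k ε hε
    obtain ⟨N2, h2⟩ := hlo k ε hε
    exact ⟨max N1 N2, fun N hN => ⟨h1 N ((le_max_left _ _).trans hN), h2 N ((le_max_right _ _).trans hN)⟩⟩
  obtain ⟨N1, h1⟩ := key 0
  obtain ⟨N2, h2⟩ := key 1
  refine ⟨(max N1 N2).toNat, fun N hN k => ?_⟩
  have hN' : max N1 N2 ≤ (N + 1 : ℕ) := by have := Int.self_le_toNat (max N1 N2); push_cast; omega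
  have e1 : ((N + 1 : ℕ) : ℤ) + 1 = (N + 2 : ℕ) := by push_cast; ring
  have e2 : ((N + 1 : ℕ) : ℤ) + -1 = (N : ℕ) := by push_cast; ring
  rw [← e1, ← e2]
  fin_cases k
  · exact h1 _ ((le_max_left _ _).trans hN')
  · exact h2 _ ((le_max_right _ _).trans hN')

theorem Gd_stable {F : C(S3, S3)} (ε : ℝ) (hε : 0 < ε) :
    ∀ᶠ F' in nhds F, ∀ N, Gd N ε F → Gd N (2 * ε) F' := by
  have h1 : ∀ k, ∀ᶠ F' in nhds F, ‖up F' k - up F k‖ < ε := fun k => by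
    have := Metric.tendsto_nhds.1 ((continuous_up k).tendsto F) ε hε
    simpa [dist_eq_norm] using this
  have h2 : ∀ k, ∀ᶠ F' in nhds F, ‖lo F' k - lo F k‖ < ε := fun k => by
    have := Metric.tendsto_nhds.1 ((continuous_lo k).tendsto F) ε hε
    simpa [dist_eq_norm] using this
  have tri : ∀ (φ φ' p q : C(S3, ℂ)), ‖φ' - φ‖ < ε → ‖J (φ * p) - J q‖ ≤ ε * ‖J p‖ →
      ‖J (φ' * p) - J q‖ ≤ 2 * ε * ‖J p‖ := by
    intro φ φ' p q hd h
    have e : J (φ' * p) - J q = J ((φ' - φ) * p) + (J (φ * p) - J q) := by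
      rw [sub_mul, map_sub]; abel
    rw [e]
    refine (norm_add_le _ _).trans ?_
    have h3 := J_mul_le (φ' - φ) p
    have h4 : ‖φ' - φ‖ * ‖J p‖ ≤ ε * ‖J p‖ := by gcongr
    linarith
  filter_upwards [h1 0, h1 1, h2 0, h2 1] with F' a0 a1 b0 b1
  intro N hG k
  have a : ‖up F' k - up F k‖ < ε := by fin_cases k <;> assumption
  have b : ‖lo F' k - lo F k‖ < ε := by fin_cases k <;> assumption
  constructor
  · intro p hp
    obtain ⟨q, hq, h⟩ := (hG k).1 p hp
    exact ⟨q, hq, tri _ _ _ _ a h⟩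
  · intro p hp
    obtain ⟨q, hq, h⟩ := (hG k).2 p hp
    exact ⟨q, hq, tri _ _ _ _ b h⟩

theorem small_of_orth {g q : Hs} {c : ℝ} (h : inner ℂ q g = 0) (hd : ‖g - q‖ ≤ c) : ‖g‖ ≤ c := by
  have h1 : inner ℂ (g - q) g = ((‖g‖ ^ 2 : ℝ) : ℂ) := by
    rw [inner_sub_left, h, sub_zero, inner_self_c]
  have h2 := norm_inner_le_norm (𝕜 := ℂ) (g - q) g
  rw [h1, norm_real, Real.norm_eq_abs, abs_of_nonneg (sq_nonneg _)] at h2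
  rcases eq_or_lt_of_le (norm_nonneg g) with h3 | h3
  · rw [← h3]; exact (norm_nonneg _).trans hd
  · nlinarith

theorem orth_Pn (n : ℕ) (g : Hs) (h : ∀ a : Fin (n + 1), inner ℂ (J (mon a (n - a))) g = 0)
    (q : C(S3, ℂ)) (hq : q ∈ Pn n) : inner ℂ (J q) g = 0 := by
  obtain ⟨c, rfl⟩ := Pn_repr n q hq
  rw [map_sum, sum_inner]
  refine Finset.sum_eq_zero fun a ha => ?_
  rw [map_smul, inner_smul_left, h ⟨a, Finset.mem_range.1 ha⟩, mul_zero]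

/-- polynomial with given coefficients -/
noncomputable def poly (N : ℕ) (x : Fin (N + 2) → ℂ) : C(S3, ℂ) :=
  ∑ c : Fin (N + 2), x c • mon c (N + 1 - c)

theorem poly_mem (N : ℕ) (x : Fin (N + 2) → ℂ) : poly N x ∈ Pn (N + 1 : ℕ) := by
  refine Submodule.sum_mem _ fun c _ => Submodule.smul_mem _ _ (mon_mem _ _ _ ?_)
  have := c.2
  omega

theorem poly_zero (N : ℕ) (x : Fin (N + 2) → ℂ) (h : J (poly N x) = 0) : x = 0 := by
  ext a
  have h1 : inner ℂ (J (mon a (N + 1 - a))) (J (poly N x)) = 0 := by rw [h, inner_zero_right]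
  unfold poly at h1
  rw [map_sum, inner_sum, Finset.sum_eq_single a] at h1
  · rw [map_smul, inner_smul_right, inner_mon_self] at h1
    rcases mul_eq_zero.1 h1 with h2 | h2
    · exact h2
    · have h3 : 2 * Real.pi * bet a (N + 1 - a) = 0 := by exact_mod_cast h2
      have h4 := bet_pos a (N + 1 - a)
      have h5 := Real.pi_pos
      have : 0 < 2 * Real.pi * bet a (N + 1 - a) := by positivity
      linarith
  · intro b _ hb
    rw [map_smul, inner_smul_right, inner_mon, mul_zero]
    have := a.2; have := b.2
    have : (a : ℕ) ≠ b := fun h => hb (Fin.ext h.symm)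
    omega
  · intro h; exact absurd (Finset.mem_univ _) h

theorem DM_ne (N : ℕ) (F : C(S3, S3)) (hG : Gd N (1 / 4) F) : DM N F ≠ 0 := by
  intro h0
  obtain ⟨x, hx, hMx⟩ := Matrix.exists_mulVec_eq_zero_iff.2 h0
  apply hx
  set p : Fin 2 → C(S3, ℂ) := fun k => poly N fun c => x (k, c) with hp
  have hpm : ∀ k, p k ∈ Pn (N + 1 : ℕ) := fun k => poly_mem _ _
  have hrow : ∀ i, ∑ j, rowM N F i j * x j = 0 := by
    intro i
    have := congrFun hMx (ee N i)
    simpa [Matrix.mulVec, dotProduct] using this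
  set g : C(S3, ℂ) := up F 0 * p 0 + up F 1 * p 1 with hg
  set g' : C(S3, ℂ) := lo F 0 * p 0 + lo F 1 * p 1 with hg'
  have expand : ∀ (s : Fin 2 → C(S3, ℂ)) (m : Hs), inner ℂ m (J (s 0 * p 0 + s 1 * p 1)) =
      ∑ j : Fin 2 × Fin (N + 2), inner ℂ m (J (s j.1 * mon j.2 (N + 1 - j.2))) * x j := by
    intro s m
    rw [Fintype.sum_prod_type, Fin.sum_univ_two, map_add, inner_add_right]
    have : ∀ k, inner ℂ m (J (s k * p k)) =
        ∑ c : Fin (N + 2), inner ℂ m (J (s k * mon c (N + 1 - c))) * x (k, c) := by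
      intro k
      simp only [hp, poly]
      rw [Finset.mul_sum, map_sum, inner_sum]
      refine Finset.sum_congr rfl fun c _ => ?_
      rw [mul_smul_comm, map_smul, inner_smul_right, mul_comm]
    rw [this, this]
  have o1 : ∀ q ∈ Pn (N + 2 : ℕ), inner ℂ (J q) (J g) = 0 := by
    refine orth_Pn _ _ fun a => ?_
    rw [hg, expand (up F)]
    exact hrow (Sum.inl a)
  have o2 : ∀ q ∈ Pn (N : ℕ), inner ℂ (J q) (J g') = 0 := by
    refine orth_Pn _ _ fun a => ?_
    rw [hg', expand (lo F)]
    exact hrow (Sum.inr a)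
  have b1 : ‖J g‖ ≤ 1 / 4 * (‖J (p 0)‖ + ‖J (p 1)‖) := by
    obtain ⟨q0, hq0, e0⟩ := (hG 0).1 _ (hpm 0)
    obtain ⟨q1, hq1, e1⟩ := (hG 1).1 _ (hpm 1)
    refine small_of_orth (o1 _ (add_mem hq0 hq1)) ?_
    have : J g - J (q0 + q1) = (J (up F 0 * p 0) - J q0) + (J (up F 1 * p 1) - J q1) := by
      rw [hg, map_add, map_add]; abel
    rw [this]
    refine (norm_add_le _ _).trans ?_
    linarith
  have b2 : ‖J g'‖ ≤ 1 / 4 * (‖J (p 0)‖ + ‖J (p 1)‖) := by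
    obtain ⟨q0, hq0, e0⟩ := (hG 0).2 _ (hpm 0)
    obtain ⟨q1, hq1, e1⟩ := (hG 1).2 _ (hpm 1)
    refine small_of_orth (o2 _ (add_mem hq0 hq1)) ?_
    have : J g' - J (q0 + q1) = (J (lo F 0 * p 0) - J q0) + (J (lo F 1 * p 1) - J q1) := by
      rw [hg', map_add, map_add]; abel
    rw [this]
    refine (norm_add_le _ _).trans ?_
    linarith
  have pyth : ‖J g‖ ^ 2 + ‖J g'‖ ^ 2 = ‖J (p 0)‖ ^ 2 + ‖J (p 1)‖ ^ 2 := by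
    refine norm_J_sum _ _ _ _ fun z => ?_
    have e1 : g z = (F z).1.1 * p 0 z + (F z).1.2 * p 1 z := rfl
    have e2 : g' z = conj (F z).1.2 * p 0 z + -conj (F z).1.1 * p 1 z := rfl
    rw [e1, e2]
    simp only [← normSq_eq_norm_sq, normSq_apply, add_re, add_im, mul_re, mul_im, neg_re, neg_im,
      conj_re, conj_im]
    have := (F z).eqn
    linear_combination ((p 0 z).re ^ 2 + (p 0 z).im ^ 2 + ((p 1 z).re ^ 2 + (p 1 z).im ^ 2)) * this
  have n0 := norm_nonneg (J (p 0))
  have n1 := norm_nonneg (J (p 1))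
  have s1 : ‖J g‖ ^ 2 ≤ (1 / 4 * (‖J (p 0)‖ + ‖J (p 1)‖)) ^ 2 := by gcongr
  have s2 : ‖J g'‖ ^ 2 ≤ (1 / 4 * (‖J (p 0)‖ + ‖J (p 1)‖)) ^ 2 := by gcongr
  have z0 : ‖J (p 0)‖ ^ 2 + ‖J (p 1)‖ ^ 2 ≤ 0 := by
    nlinarith [sq_nonneg (‖J (p 0)‖ - ‖J (p 1)‖)]
  have y0 : J (p 0) = 0 := by
    rw [← norm_eq_zero]; nlinarith
  have y1 : J (p 1) = 0 := by
    rw [← norm_eq_zero]; nlinarith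
  ext ⟨k, c⟩
  fin_cases k
  · exact congrFun (poly_zero N _ y0) c
  · exact congrFun (poly_zero N _ y1) c

theorem DM_compact (K : Set C(S3, S3)) (hK : IsCompact K) (h : ∀ F ∈ K, Eqv F) :
    ∃ N, ∀ F ∈ K, DM N F ≠ 0 := by
  have : ∃ N0, ∀ N ≥ N0, ∀ F ∈ K, DM N F ≠ 0 := by
    refine hK.induction_on (p := fun S => ∃ N0, ∀ N ≥ N0, ∀ F ∈ S, DM N F ≠ 0) ⟨0, by simp⟩ ?_ ?_ ?_
    · rintro s t hst ⟨N0, h0⟩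
      exact ⟨N0, fun N hN F hF => h0 N hN F (hst hF)⟩
    · rintro s t ⟨N0, h0⟩ ⟨N1, h1⟩
      refine ⟨max N0 N1, fun N hN F hF => ?_⟩
      rcases hF with hF | hF
      · exact h0 N ((le_max_left _ _).trans hN) F hF
      · exact h1 N ((le_max_right _ _).trans hN) F hF
    · intro F hF
      obtain ⟨N0, h0⟩ := Gd_of_Eqv (h F hF) (1 / 8) (by norm_num)
      refine ⟨_, mem_nhdsWithin_of_mem_nhds (Gd_stable (F := F) (1 / 8) (by norm_num)), N0, ?_⟩
      intro N hN F' hF'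
      refine DM_ne N F' ?_
      have := hF' N (h0 N hN)
      norm_num at this
      exact this
  obtain ⟨N0, h0⟩ := this
  exact ⟨N0, h0 N0 le_rfl⟩

/-- multiply a map by a circle valued function -/
noncomputable def gm (g : C(S3, Circle)) (F : C(S3, S3)) : C(S3, S3) :=
  ⟨fun z => act (g z) (F z), continuous_act.comp (g.continuous.prodMk F.continuous)⟩

theorem DM_gm_const (N : ℕ) (u : Circle) (F : C(S3, S3)) :
    DM N (gm (ContinuousMap.const _ u) F) = (u : ℂ) ^ 2 * DM N F := by
  let d : Fin (N + 3) ⊕ Fin (N + 1) → ℂ := Sum.elim (fun _ => (u : ℂ)) (fun _ => conj (u : ℂ))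
  have hr : ∀ i j, rowM N (gm (ContinuousMap.const _ u) F) i j = d i * rowM N F i j := by
    intro i j
    rcases i with a | a
    · have e : up (gm (ContinuousMap.const _ u) F) j.1 * mon j.2 (N + 1 - j.2) =
          (u : ℂ) • (up F j.1 * mon j.2 (N + 1 - j.2)) := by
        unfold up; split_ifs <;> (ext z; simp [c1_apply, c2_apply, gm, act, mul_assoc])
      simp only [rowM, Sum.elim_inl, d]
      rw [e, map_smul, inner_smul_right]
    · have e : lo (gm (ContinuousMap.const _ u) F) j.1 * mon j.2 (N + 1 - j.2) =
          conj (u : ℂ) • (lo F j.1 * mon j.2 (N + 1 - j.2)) := by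
        unfold lo; split_ifs <;> (ext z; simp [c1_apply, c2_apply, gm, act, mul_assoc])
      simp only [rowM, Sum.elim_inr, d]
      rw [e, map_smul, inner_smul_right]
  have hm : (rowM N (gm (ContinuousMap.const _ u) F)).submatrix (ee N).symm id =
      Matrix.of fun i j => d ((ee N).symm i) * ((rowM N F).submatrix (ee N).symm id) i j := by
    ext i j; simp [hr]
  unfold DM
  rw [hm, Matrix.det_mul_column, Equiv.prod_comp (ee N).symm d]
  congr 1
  simp only [d, Fintype.prod_sum_type, Sum.elim_inl, Sum.elim_inr, Finset.prod_const,
    Finset.card_univ, Fintype.card_fin]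
  have : (u : ℂ) ^ (N + 3) * conj (u : ℂ) ^ (N + 1) = u ^ 2 * (u * conj (u : ℂ)) ^ (N + 1) := by
    rw [mul_pow]; ring
  rw [this, circ_conj]; simp

theorem DM_Ulift (N : ℕ) (v : S3) : DM N (Ulift v) = DM N (ContinuousMap.id S3) := by
  let B : Matrix (Fin 2) (Fin 2) ℂ := !![v.1.1, v.1.2; -conj v.1.2, conj v.1.1]
  have hB : B.det = 1 := by
    rw [Matrix.det_fin_two_of]
    linear_combination mul_conj_add v
  have hm : (rowM N (Ulift v)).submatrix (ee N).symm id =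
      (rowM N (ContinuousMap.id S3)).submatrix (ee N).symm id *
        Matrix.kroneckerMap (fun x y => x * y) B (1 : Matrix (Fin (N + 2)) (Fin (N + 2)) ℂ) := by
    ext i ⟨k, c⟩
    rw [Matrix.mul_apply, Fintype.sum_prod_type, Fin.sum_univ_two]
    simp only [Matrix.submatrix_apply, id, Matrix.kroneckerMap_apply, Matrix.one_apply, mul_ite,
      mul_one, mul_zero, Finset.sum_ite_eq', Finset.mem_univ, if_true]
    have eu : up (Ulift v) k = B 0 k • up (ContinuousMap.id S3) 0 +
        B 1 k • up (ContinuousMap.id S3) 1 := by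
      fin_cases k
      · ext z; change v.1.1 * z.1.1 - conj v.1.2 * z.1.2 = v.1.1 * z.1.1 + -conj v.1.2 * z.1.2
        ring
      · ext z; rfl
    have el : lo (Ulift v) k = B 0 k • lo (ContinuousMap.id S3) 0 +
        B 1 k • lo (ContinuousMap.id S3) 1 := by
      fin_cases k
      · ext z
        change conj (v.1.2 * z.1.1 + conj v.1.1 * z.1.2) =
          v.1.1 * conj z.1.2 + -conj v.1.2 * (-conj z.1.1)
        simp; ring
      · ext z
        change -conj (v.1.1 * z.1.1 - conj v.1.2 * z.1.2) =
          v.1.2 * conj z.1.2 + conj v.1.1 * (-conj z.1.1)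
        simp; ring
    rcases (ee N).symm i with a | a
    · simp only [rowM, Sum.elim_inl]
      rw [eu, add_mul, smul_mul_assoc, smul_mul_assoc, map_add, map_smul, map_smul,
        inner_add_right, inner_smul_right, inner_smul_right]
      ring
    · simp only [rowM, Sum.elim_inr]
      rw [el, add_mul, smul_mul_assoc, smul_mul_assoc, map_add, map_smul, map_smul,
        inner_add_right, inner_smul_right, inner_smul_right]
      ring
  unfold DM
  rw [hm, Matrix.det_mul, Matrix.det_kronecker, hB]
  simp

/-- phase of a nonzero complex number -/
noncomputable def phc (w : ℂ) (h : w ≠ 0) : Circle := ⟨w / ‖w‖, by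
    change _ ∈ Metric.sphere (0 : ℂ) 1
    rw [mem_sphere_zero_iff_norm, norm_div, norm_real, norm_norm, div_self (norm_ne_zero_iff.2 h)]⟩

theorem phc_coe (w : ℂ) (h : w ≠ 0) : (phc w h : ℂ) = w / ‖w‖ := rfl

open Classical in
/-- phase of a complex number -/
noncomputable def ph (w : ℂ) : Circle := if h : w ≠ 0 then phc w h else 1

theorem ph_coe (w : ℂ) (h : w ≠ 0) : (ph w : ℂ) = w / ‖w‖ := by
  unfold ph; rw [dif_pos h, phc_coe]

theorem ph_mul (u : Circle) (w : ℂ) (h : w ≠ 0) : ph (u * w) = u * ph w := by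
  apply Circle.ext
  rw [ph_coe _ (mul_ne_zero (Circle.coe_ne_zero u) h), Circle.coe_mul, ph_coe _ h, norm_mul,
    Circle.norm_coe, one_mul, mul_div_assoc]

theorem ph_cont : ContinuousOn ph {w | w ≠ 0} := by
  rw [continuousOn_iff_continuous_domRestrict]
  have : Continuous fun w : {w : ℂ | w ≠ 0} => w.1 / (‖w.1‖ : ℂ) :=
    Continuous.div (by fun_prop) (by fun_prop) fun w => by
      have h : w.1 ≠ 0 := w.2
      exact ofReal_ne_zero.2 (norm_ne_zero_iff.2 h)
  refine Topology.IsInducing.continuous_iff Topology.IsInducing.subtypeVal |>.2 ?_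
  exact this.congr fun w => (ph_coe w.1 w.2).symm

/-- phase of the determinant -/
noncomputable def dl (N : ℕ) (F : C(S3, S3)) : Circle :=
  ph (DM N F) * (ph (DM N (ContinuousMap.id S3)))⁻¹

theorem dl_Ulift (N : ℕ) (v : S3) : dl N (Ulift v) = 1 := by
  unfold dl; rw [DM_Ulift]; simp

theorem dl_gm (N : ℕ) (u : Circle) (F : C(S3, S3)) (h : DM N F ≠ 0) :
    dl N (gm (ContinuousMap.const _ u) F) = u ^ 2 * dl N F := by
  unfold dl
  rw [DM_gm_const]
  have : (u : ℂ) ^ 2 * DM N F = ((u ^ 2 : Circle) : ℂ) * DM N F := by simp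
  rw [this, ph_mul _ _ h, mul_assoc]

theorem dl_cont (N : ℕ) : ContinuousOn (dl N) {F | DM N F ≠ 0} := by
  unfold dl
  exact (ph_cont.comp (continuous_DM N).continuousOn fun F hF => hF).mul continuousOn_const

end S19

namespace S19
open Complex ComplexConjugate

/-- same fibres -/
def SF (F G : C(S3, S3)) : Prop := ∀ z, hopf (F z) = hopf (G z)

theorem IsLift.sf {f : C(Sph2, Sph2)} {F G : C(S3, S3)} (h : IsLift f F) (h' : IsLift f G) :
    SF F G := fun z => by rw [h.2, h'.2]

/-- the joint ratio map -/
noncomputable def ratJ : C({p : C(S3, S3) × C(S3, S3) // SF p.1 p.2} × S3, Circle) where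
  toFun q := ratio (q.1.1.1 q.2) (q.1.1.2 q.2) (q.1.2 q.2)
  continuous_toFun := by
    refine Topology.IsInducing.continuous_iff Topology.IsInducing.subtypeVal |>.2 ?_
    change Continuous fun q : {p : C(S3, S3) × C(S3, S3) // SF p.1 p.2} × S3 =>
      ip (q.1.1.1 q.2).1 (q.1.1.2 q.2).1
    have h1 : Continuous fun q : {p : C(S3, S3) × C(S3, S3) // SF p.1 p.2} × S3 => q.1.1.1 := by fun_prop
    have h2 : Continuous fun q : {p : C(S3, S3) × C(S3, S3) // SF p.1 p.2} × S3 => q.1.1.2 := by fun_prop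
    have h3 := h1.eval continuous_snd
    have h4 := h2.eval continuous_snd
    unfold ip
    fun_prop

open Classical in
/-- the ratio of two maps -/
noncomputable def rat (F G : C(S3, S3)) : C(S3, Circle) :=
  if h : SF F G then ratJ.curry ⟨(F, G), h⟩ else 1

theorem rat_apply {F G : C(S3, S3)} (h : SF F G) (z : S3) :
    rat F G z = ratio (F z) (G z) (h z) := by
  unfold rat; rw [dif_pos h]; rfl

theorem rat_cont : ContinuousOn (fun p : C(S3, S3) × C(S3, S3) => rat p.1 p.2) {p | SF p.1 p.2} := by
  rw [continuousOn_iff_continuous_domRestrict]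
  refine ratJ.curry.continuous.congr fun p => ?_
  have : SF p.1.1 p.1.2 := p.2
  simp only [Set.domRestrict_apply, rat]
  rw [dif_pos this]

theorem continuous_gm : Continuous fun p : C(S3, Circle) × C(S3, S3) => gm p.1 p.2 := by
  let G : C((C(S3, Circle) × C(S3, S3)) × S3, S3) :=
    ⟨fun q => act (q.1.1 q.2) (q.1.2 q.2), by
      refine continuous_act.comp (Continuous.prodMk ?_ ?_)
      · exact (by fun_prop : Continuous fun q : (C(S3, Circle) × C(S3, S3)) × S3 => q.1.1).eval continuous_snd
      · exact (by fun_prop : Continuous fun q : (C(S3, Circle) × C(S3, S3)) × S3 => q.1.2).eval continuous_snd⟩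
  exact G.curry.continuous

theorem gm_apply (g : C(S3, Circle)) (F : C(S3, S3)) (z : S3) : gm g F z = act (g z) (F z) := rfl

theorem gm_gm (g h : C(S3, Circle)) (F : C(S3, S3)) : gm g (gm h F) = gm (g * h) F := by
  ext1 z; simp only [gm_apply, act_act]; rfl

theorem gm_one (F : C(S3, S3)) : gm 1 F = F := by
  ext1 z; simp only [gm_apply, ContinuousMap.one_apply, one_act]

theorem SF_gm {F G : C(S3, S3)} (h : SF F G) (g : C(S3, Circle)) : SF F (gm g G) := fun z => by
  rw [gm_apply, hopf_act, h]

theorem act_rat {F G : C(S3, S3)} (h : SF F G) : gm (rat F G) F = G := by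
  ext1 z
  rw [gm_apply, rat_apply h, act_ratio]

theorem rat_gm {F G : C(S3, S3)} (h : SF F G) (g : C(S3, Circle)) :
    rat F (gm g G) = rat F G * g := by
  ext1 z
  apply act_inj (z := F z)
  rw [rat_apply (SF_gm h g), act_ratio, gm_apply, ContinuousMap.mul_apply, mul_comm, ← act_act,
    rat_apply h, act_ratio]

theorem rat_inv {F G : C(S3, S3)} (h : SF F G) (hF : Eqv F) (hG : Eqv G) (u : Circle) (z : S3) :
    rat F G (act u z) = rat F G z := by
  apply act_inj (z := F (act u z))
  rw [rat_apply h, act_ratio, hF, hG, act_act, mul_comm, ← act_act, rat_apply h, act_ratio]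

/-- pointwise exponential -/
noncomputable def ex (b : C(S3, ℝ)) : C(S3, Circle) := Circle.exp.comp b

theorem ex_apply (b : C(S3, ℝ)) (z : S3) : ex b z = Circle.exp (b z) := rfl
theorem continuous_ex : Continuous ex := ContinuousMap.continuous_postcomp _
theorem ex_zero : ex 0 = 1 := by ext1 z; simp [ex_apply]
theorem ex_add (b c : C(S3, ℝ)) : ex (b + c) = ex b * ex c := by
  ext1 z; simp [ex_apply, Circle.exp_add]

/-- charts near finitely many maps with lifts -/
structure Cov where
  /-- number -/
  n : ℕ
  /-- centers -/
  cen : Fin n → C(Sph2, Sph2)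
  /-- lifts -/
  L : Fin n → C(S3, S3)
  /-- they are lifts -/
  hL : ∀ i, IsLift (cen i) (L i)

variable (C : Cov)

/-- weights -/
noncomputable def Cov.w (i : Fin C.n) (f : C(Sph2, Sph2)) : ℝ := max 0 (1 - dist f (C.cen i))
/-- total weight -/
noncomputable def Cov.W (f : C(Sph2, Sph2)) : ℝ := ∑ i, C.w i f
/-- local lifts -/
noncomputable def Cov.s (i : Fin C.n) (f : C(Sph2, Sph2)) : C(S3, S3) := sl (C.cen i) (C.L i) (C.hL i) f

theorem Cov.continuous_w (i : Fin C.n) : Continuous (C.w i) := by unfold Cov.w; fun_prop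
theorem Cov.continuous_W : Continuous C.W := by
  unfold Cov.W; exact continuous_finsetSum _ fun i _ => C.continuous_w i

theorem Cov.w_eq_zero (i : Fin C.n) (f : C(Sph2, Sph2)) (h : 1 ≤ dist f (C.cen i)) : C.w i f = 0 := by
  unfold Cov.w; exact max_eq_left (by linarith)

theorem Cov.exists_near {f : C(Sph2, Sph2)} (h : 0 < C.W f) : ∃ i, dist f (C.cen i) < 1 := by
  by_contra! hc
  have : C.W f = 0 := Finset.sum_eq_zero fun i _ => C.w_eq_zero i f (hc i)
  linarith

theorem Cov.s_lift {i : Fin C.n} {f : C(Sph2, Sph2)} (h : dist f (C.cen i) < 2) : IsLift f (C.s i f) :=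
  sl_isLift _ h

theorem Cov.s_cont (i : Fin C.n) : ContinuousOn (C.s i) (Metric.ball (C.cen i) 2) := sl_cont (C.hL i)

/-- averaged logarithm -/
noncomputable def Cov.bt (f : C(Sph2, Sph2)) (F : C(S3, S3)) : C(S3, ℝ) :=
  ∑ i, (C.w i f / C.W f) • Lg (rat (C.s i f) F)

/-- the good domain -/
def Cov.D : Set (C(Sph2, Sph2) × C(S3, S3)) := {p | IsLift p.1 p.2 ∧ 0 < C.W p.1}

theorem Cov.bt_cont : ContinuousOn (fun p : C(Sph2, Sph2) × C(S3, S3) => C.bt p.1 p.2) C.D := by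
  unfold Cov.bt
  refine continuousOn_finsetSum _ fun i _ => ?_
  intro p hp
  by_cases hd : dist p.1 (C.cen i) < 2
  · have hU : {p : C(Sph2, Sph2) × C(S3, S3) | dist p.1 (C.cen i) < 2} ∈ nhds p :=
      (isOpen_lt (by fun_prop) continuous_const).mem_nhds hd
    have hc : ContinuousOn (fun p : C(Sph2, Sph2) × C(S3, S3) =>
        (C.w i p.1 / C.W p.1) • Lg (rat (C.s i p.1) p.2))
        (C.D ∩ {p : C(Sph2, Sph2) × C(S3, S3) | dist p.1 (C.cen i) < 2}) := by
      have hsuff : ContinuousOn (fun p : C(Sph2, Sph2) × C(S3, S3) => rat (C.s i p.1) p.2)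
          (C.D ∩ {p : C(Sph2, Sph2) × C(S3, S3) | dist p.1 (C.cen i) < 2}) := by
        refine rat_cont.comp (f := fun p : C(Sph2, Sph2) × C(S3, S3) => (C.s i p.1, p.2)) ?_ ?_
        · refine ContinuousOn.prodMk ((C.s_cont i).comp continuousOn_fst fun q hq => hq.2) continuousOn_snd
        · intro q hq
          exact (C.s_lift hq.2).sf hq.1.1
      have hw : ContinuousOn (fun p : C(Sph2, Sph2) × C(S3, S3) => C.w i p.1 / C.W p.1)
          (C.D ∩ {p : C(Sph2, Sph2) × C(S3, S3) | dist p.1 (C.cen i) < 2}) := by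
        refine ContinuousOn.div ?_ ?_ fun q hq => ne_of_gt hq.1.2
        · exact ((C.continuous_w i).comp continuous_fst).continuousOn
        · exact (C.continuous_W.comp continuous_fst).continuousOn
      exact hw.smul (continuous_Lg.comp_continuousOn hsuff)
    have := hc p ⟨hp, hd⟩
    rwa [continuousWithinAt_inter hU] at this
  · have hU : {p : C(Sph2, Sph2) × C(S3, S3) | 1 < dist p.1 (C.cen i)} ∈ nhds p :=
      (isOpen_lt continuous_const (by fun_prop)).mem_nhds (by push Not at hd; exact lt_of_lt_of_le one_lt_two hd)
    refine ContinuousAt.continuousWithinAt ?_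
    refine (continuousAt_const (y := (0 : C(S3, ℝ)))).congr ?_
    filter_upwards [hU] with q hq
    rw [C.w_eq_zero i _ (le_of_lt hq)]; simp

theorem Cov.bt_gm {f : C(Sph2, Sph2)} {F : C(S3, S3)} (h : (f, F) ∈ C.D) (g : C(S3, Circle)) :
    C.bt f (gm g F) = C.bt f F + Lg g := by
  have h1 : ∀ i, (C.w i f / C.W f) • Lg (rat (C.s i f) (gm g F)) =
      (C.w i f / C.W f) • Lg (rat (C.s i f) F) + (C.w i f / C.W f) • Lg g := by
    intro i
    by_cases hd : dist f (C.cen i) < 2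
    · rw [rat_gm ((C.s_lift hd).sf h.1), Lg_mul, smul_add]
    · push Not at hd
      rw [C.w_eq_zero i f (by linarith)]; simp
  unfold Cov.bt
  simp_rw [h1]
  rw [Finset.sum_add_distrib, ← Finset.sum_smul, ← Finset.sum_div]
  change _ + (C.W f / C.W f) • Lg g = _
  rw [div_self h.2.ne', one_smul]

theorem Cov.bt_e3 (f : C(Sph2, Sph2)) (F : C(S3, S3)) : C.bt f F e3 = 0 := by
  unfold Cov.bt
  rw [ContinuousMap.sum_apply]
  exact Finset.sum_eq_zero fun i _ => by simp [Lg_e3]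

theorem Cov.bt_act {f : C(Sph2, Sph2)} {F : C(S3, S3)} (h : (f, F) ∈ C.D) (u : Circle) (z : S3) :
    C.bt f F (act u z) = C.bt f F z := by
  unfold Cov.bt
  rw [ContinuousMap.sum_apply, ContinuousMap.sum_apply]
  refine Finset.sum_congr rfl fun i _ => ?_
  by_cases hd : dist f (C.cen i) < 2
  · have hs := C.s_lift hd
    rw [ContinuousMap.smul_apply, ContinuousMap.smul_apply,
      Lg_act _ (rat_inv (hs.sf h.1) hs.1 h.1.1)]
  · push Not at hd
    rw [C.w_eq_zero i f (by linarith)]; simp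

/-- gauge fixed lifts -/
noncomputable def Cov.Gam (s : ℝ) (f : C(Sph2, Sph2)) (F : C(S3, S3)) : C(S3, S3) :=
  gm (ex (-(s • C.bt f F))) F

theorem Cov.Gam_zero (f : C(Sph2, Sph2)) (F : C(S3, S3)) : C.Gam 0 f F = F := by
  unfold Cov.Gam; rw [zero_smul, neg_zero, ex_zero, gm_one]

theorem Cov.Gam_cont : ContinuousOn (fun q : ℝ × C(Sph2, Sph2) × C(S3, S3) => C.Gam q.1 q.2.1 q.2.2)
    (Set.univ ×ˢ C.D) := by
  unfold Cov.Gam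
  have h1 : ContinuousOn (fun q : ℝ × C(Sph2, Sph2) × C(S3, S3) => C.bt q.2.1 q.2.2)
    (Set.univ ×ˢ C.D) := C.bt_cont.comp continuousOn_snd fun q hq => hq.2
  have h2 : ContinuousOn (fun q : ℝ × C(Sph2, Sph2) × C(S3, S3) => ex (-(q.1 • C.bt q.2.1 q.2.2)))
    (Set.univ ×ˢ C.D) := continuous_ex.comp_continuousOn (continuousOn_fst.smul h1).neg
  exact continuous_gm.comp_continuousOn (h2.prodMk continuousOn_snd.snd)

theorem Cov.Gam_eqv {f : C(Sph2, Sph2)} {F : C(S3, S3)} (h : (f, F) ∈ C.D) (s : ℝ) :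
    Eqv (C.Gam s f F) := by
  intro u z
  unfold Cov.Gam
  simp only [gm_apply, ex_apply, ContinuousMap.neg_apply, ContinuousMap.smul_apply, C.bt_act h]
  rw [h.1.1, act_act, act_act, mul_comm]

theorem Cov.Gam_const {f : C(Sph2, Sph2)} {F : C(S3, S3)} (h : (f, F) ∈ C.D) (s : ℝ) (u : Circle) :
    C.Gam s f (gm (ContinuousMap.const _ u) F) = gm (ContinuousMap.const _ u) (C.Gam s f F) := by
  unfold Cov.Gam
  rw [C.bt_gm h, Lg_const, add_zero, gm_gm, gm_gm, mul_comm]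

theorem Cov.Gam_gm {f : C(Sph2, Sph2)} {F : C(S3, S3)} (h : (f, F) ∈ C.D) (g : C(S3, Circle)) :
    C.Gam 1 f (gm g F) = gm (ContinuousMap.const _ (g e3)) (C.Gam 1 f F) := by
  unfold Cov.Gam
  rw [C.bt_gm h, gm_gm, gm_gm]
  congr 1
  ext1 z
  simp only [one_smul, ContinuousMap.mul_apply, ex_apply, ContinuousMap.neg_apply,
    ContinuousMap.add_apply, ContinuousMap.const_apply]
  rw [neg_add, Circle.exp_add, Circle.exp_neg (Lg g z), exp_Lg]
  rw [mul_inv, inv_inv, mul_assoc, mul_right_comm (g z)⁻¹, inv_mul_cancel, one_mul, mul_comm]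

/-- the matrix of a lift -/
noncomputable def Cov.R (N : ℕ) (s : ℝ) (f : C(Sph2, Sph2)) (F : C(S3, S3)) :
    Matrix.specialOrthogonalGroup (Fin 3) ℝ := ⟨Tm (F e3) (dl N (C.Gam s f F)), Tm_mem _ _⟩

theorem Cov.R_const {f : C(Sph2, Sph2)} {F : C(S3, S3)} (h : (f, F) ∈ C.D) (N : ℕ) (s : ℝ)
    (u : Circle) (hN : DM N (C.Gam s f F) ≠ 0) :
    C.R N s f (gm (ContinuousMap.const _ u) F) = C.R N s f F := by
  apply Subtype.ext
  simp only [Cov.R]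
  rw [C.Gam_const h, dl_gm _ _ _ hN, gm_apply, ContinuousMap.const_apply, Tm_act]

theorem Cov.R_lift {f : C(Sph2, Sph2)} {F G : C(S3, S3)} (h : (f, F) ∈ C.D) (hG : IsLift f G) (N : ℕ)
    (hN : DM N (C.Gam 1 f F) ≠ 0) : C.R N 1 f G = C.R N 1 f F := by
  rw [← act_rat (h.1.sf hG)]
  apply Subtype.ext
  simp only [Cov.R]
  rw [C.Gam_gm h, dl_gm _ _ _ hN, gm_apply, Tm_act]

theorem Cov.DM_lift {f : C(Sph2, Sph2)} {F G : C(S3, S3)} (h : (f, F) ∈ C.D) (hG : IsLift f G) (N : ℕ)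
    (hN : DM N (C.Gam 1 f F) ≠ 0) : DM N (C.Gam 1 f G) ≠ 0 := by
  rw [← act_rat (h.1.sf hG), C.Gam_gm h, DM_gm_const]
  exact mul_ne_zero (pow_ne_zero _ (Circle.coe_ne_zero _)) hN

theorem Cov.R_cont (N : ℕ) :
    ContinuousOn (fun q : ℝ × C(Sph2, Sph2) × C(S3, S3) => C.R N q.1 q.2.1 q.2.2)
    ((Set.univ ×ˢ C.D) ∩ {q | DM N (C.Gam q.1 q.2.1 q.2.2) ≠ 0}) := by
  unfold Cov.R
  refine (Topology.IsInducing.subtypeVal.continuousOn_iff).2 ?_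
  refine continuous_Tm.comp_continuousOn (f := fun q : ℝ × C(Sph2, Sph2) × C(S3, S3) =>
    (q.2.2 e3, dl N (C.Gam q.1 q.2.1 q.2.2))) (ContinuousOn.prodMk ?_ ?_)
  · exact (by fun_prop : Continuous fun q : ℝ × C(Sph2, Sph2) × C(S3, S3) => q.2.2 e3).continuousOn
  · exact (dl_cont N).comp (C.Gam_cont.mono Set.inter_subset_left) fun q hq => hq.2

theorem Ulift_sign (v : S3) (u : Circle) (hu : u ^ 2 = 1) :
    Ulift (act u v) = gm (ContinuousMap.const _ u) (Ulift v) := by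
  have h : conj (u : ℂ) = u := by
    have h1 := circ_conj u
    have h2 : (u : ℂ) * u = 1 := by
      have := congrArg (fun w : Circle => (w : ℂ)) hu
      simpa [pow_two] using this
    exact mul_left_cancel₀ (Circle.coe_ne_zero u) (h1.trans h2.symm)
  ext1 z
  apply Subtype.ext
  change ((u * v.1.1) * z.1.1 - conj (u * v.1.2) * z.1.2, (u * v.1.2) * z.1.1 + conj (u * v.1.1) * z.1.2) =
    ((u * (v.1.1 * z.1.1 - conj v.1.2 * z.1.2), u * (v.1.2 * z.1.1 + conj v.1.1 * z.1.2)) : ℂ × ℂ)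
  rw [map_mul, map_mul, h]
  ext1 <;> simp only <;> ring

end S19

namespace S19
open Complex ComplexConjugate

theorem exists_cov (K : Set C(Sph2, Sph2)) (hK : IsCompact K) (hl : ∀ f ∈ K, ∃ F, IsLift f F) :
    ∃ C : Cov, ∀ f ∈ K, 0 < C.W f := by
  obtain ⟨t, htK, htf, hcov⟩ := hK.finite_cover_balls (e := 1) one_pos
  have : Fintype t := htf.fintype
  choose L hL using fun x : t => hl x.1 (htK x.2)
  let e := (Fintype.equivFin t).symm
  refine ⟨⟨Fintype.card t, fun i => (e i).1, fun i => L (e i), fun i => hL (e i)⟩, fun f hf => ?_⟩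
  obtain ⟨x, hx, hd⟩ := Set.mem_iUnion₂.1 (hcov hf)
  rw [Metric.mem_ball] at hd
  refine Finset.sum_pos' (fun i _ => le_max_left _ _) ⟨e.symm ⟨x, hx⟩, Finset.mem_univ _, ?_⟩
  simp only [Cov.w, Equiv.apply_symm_apply]
  exact lt_max_of_lt_right (by linarith)

/-- the rotation group -/
abbrev SOG : Type := Matrix.specialOrthogonalGroup (Fin 3) ℝ

set_option maxHeartbeats 2000000 in
theorem core (K : Set C(Sph2, Sph2)) (hK : IsCompact K) (hl : ∀ f ∈ K, ∃ F, IsLift f F)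
    (φ : C(SOG, C(Sph2, Sph2))) (hφ : ∀ A, φ A ∈ K)
    (hφ' : ∀ (A : SOG) (x : Sph2), ((φ A x).1 : Fin 3 → ℝ) = Matrix.mulVec A.1 (x.1 : Fin 3 → ℝ)) :
    ∃ r : C(K, SOG), Nonempty (ContinuousMap.Homotopy (ContinuousMap.id SOG)
      (r.comp ⟨fun A => ⟨φ A, hφ A⟩, by fun_prop⟩)) := by
  obtain ⟨C, hC⟩ := exists_cov K hK hl
  have hU : ∀ v, IsLift (φ (Rso v)) (Ulift v) := fun v => Ulift_isLift v _ fun x => hφ' _ x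
  have hUD : ∀ v, (φ (Rso v), Ulift v) ∈ C.D := fun v => ⟨hU v, hC _ (hφ _)⟩
  have hUc : Continuous fun v => (φ (Rso v), Ulift v) :=
    (φ.continuous.comp continuous_Rso).prodMk continuous_Ulift
  -- compact families
  let K1 : Fin C.n → Set C(S3, S3) := fun i =>
    (fun f => C.Gam 1 f (C.s i f)) '' (K ∩ {f | dist f (C.cen i) ≤ 1})
  let K2 : Set C(S3, S3) :=
    (fun q : unitInterval × S3 => C.Gam q.1 (φ (Rso q.2)) (Ulift q.2)) '' Set.univ
  have hGU : Continuous fun q : unitInterval × S3 => ((q.1 : ℝ), (φ (Rso q.2), Ulift q.2)) :=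
    (continuous_subtype_val.comp continuous_fst).prodMk (hUc.comp continuous_snd)
  have hK1 : ∀ i, IsCompact (K1 i) := by
    intro i
    refine IsCompact.image_of_continuousOn
      (hK.inter_right (isClosed_le (by fun_prop) continuous_const)) ?_
    refine C.Gam_cont.comp (f := fun f => ((1 : ℝ), (f, C.s i f))) ?_ ?_
    · refine continuousOn_const.prodMk (continuousOn_id.prodMk ((C.s_cont i).mono ?_))
      rintro f ⟨-, hf⟩
      have hf' : dist f (C.cen i) ≤ 1 := hf
      exact Metric.mem_ball.2 (lt_of_le_of_lt hf' one_lt_two)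
    · rintro f ⟨hfK, hf⟩
      exact ⟨trivial, C.s_lift (lt_of_le_of_lt hf one_lt_two), hC f hfK⟩
  have hK2 : IsCompact K2 := by
    refine isCompact_univ.image_of_continuousOn ?_
    exact ContinuousOn.comp (g := fun q : ℝ × C(Sph2, Sph2) × C(S3, S3) => C.Gam q.1 q.2.1 q.2.2)
      (f := fun q : unitInterval × S3 => ((q.1 : ℝ), (φ (Rso q.2), Ulift q.2)))
      C.Gam_cont hGU.continuousOn fun q _ => ⟨trivial, hUD q.2⟩
  obtain ⟨N, hN⟩ := DM_compact ((⋃ i, K1 i) ∪ K2) ((isCompact_iUnion hK1).union hK2) (by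
    rintro F (hF | ⟨q, -, rfl⟩)
    · obtain ⟨i, f, ⟨hfK, hf⟩, rfl⟩ := Set.mem_iUnion.1 hF
      exact C.Gam_eqv ⟨C.s_lift (lt_of_le_of_lt hf one_lt_two), hC f hfK⟩ 1
    · exact C.Gam_eqv (hUD q.2) _)
  have hN1 : ∀ f ∈ K, ∀ F, IsLift f F → DM N (C.Gam 1 f F) ≠ 0 := by
    intro f hf F hF
    obtain ⟨i, hi⟩ := C.exists_near (hC f hf)
    refine C.DM_lift (F := C.s i f) ⟨C.s_lift (hi.trans one_lt_two), hC f hf⟩ hF N ?_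
    exact hN _ (Or.inl (Set.mem_iUnion.2 ⟨i, f, ⟨hf, hi.le⟩, rfl⟩))
  have hN2 : ∀ (s : unitInterval) v, DM N (C.Gam s (φ (Rso v)) (Ulift v)) ≠ 0 := fun s v =>
    hN _ (Or.inr ⟨(s, v), trivial, rfl⟩)
  -- the retraction
  choose F hF using fun f : K => hl f.1 f.2
  let r0 : K → SOG := fun f => C.R N 1 f.1 (F f)
  have r0_eq : ∀ (f : K) G, IsLift f.1 G → r0 f = C.R N 1 f.1 G := fun f G hG =>
    C.R_lift ⟨hG, hC _ f.2⟩ (hF f) N (hN1 _ f.2 _ hG)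
  have r0_cont : Continuous r0 := by
    rw [continuous_iff_continuousAt]
    intro f
    obtain ⟨i, hi⟩ := C.exists_near (hC f.1 f.2)
    have hi2 : dist f.1 (C.cen i) < 2 := hi.trans one_lt_two
    let U : Set K := {f | dist f.1 (C.cen i) < 2}
    have hUo : U ∈ nhds f := (isOpen_lt (by fun_prop) continuous_const).mem_nhds hi2
    have hcont : ContinuousOn (fun f : K => C.R N 1 f.1 (C.s i f.1)) U := by
      refine (C.R_cont N).comp (f := fun f : K => ((1 : ℝ), (f.1, C.s i f.1))) ?_ ?_
      · refine continuousOn_const.prodMk (continuous_subtype_val.continuousOn.prodMk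
          ((C.s_cont i).comp continuous_subtype_val.continuousOn fun g hg => hg))
      · intro g hg
        have hl := C.s_lift (i := i) hg
        exact ⟨⟨trivial, hl, hC _ g.2⟩, hN1 _ g.2 _ hl⟩
    refine (hcont.continuousAt hUo).congr ?_
    filter_upwards [hUo] with g hg
    exact (r0_eq g _ (C.s_lift hg)).symm
  refine ⟨⟨r0, r0_cont⟩, ?_⟩
  -- the homotopy
  let h : C(unitInterval × S3, SOG) := ⟨fun q => C.R N q.1 (φ (Rso q.2)) (Ulift q.2), by
    rw [← continuousOn_univ]
    exact ContinuousOn.comp (g := fun q : ℝ × C(Sph2, Sph2) × C(S3, S3) => C.R N q.1 q.2.1 q.2.2)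
      (f := fun q : unitInterval × S3 => ((q.1 : ℝ), (φ (Rso q.2), Ulift q.2)))
      (C.R_cont N) hGU.continuousOn fun q _ => ⟨⟨trivial, hUD q.2⟩, hN2 q.1 q.2⟩⟩
  let Q : C(unitInterval × S3, unitInterval × SOG) :=
    ⟨fun q => (q.1, Rso q.2), continuous_fst.prodMk (continuous_Rso.comp continuous_snd)⟩
  have hQs : Function.Surjective Q := by
    rintro ⟨s, A⟩
    obtain ⟨v, rfl⟩ := Rso_surj A
    exact ⟨(s, v), rfl⟩
  have hQ : Topology.IsQuotientMap Q := (Q.continuous.isClosedMap).isQuotientMap Q.continuous hQs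
  have hinv : ∀ a b, Q a = Q b → h a = h b := by
    rintro ⟨s, v⟩ ⟨s', v'⟩ hab
    have e1 : s = s' := congrArg Prod.fst hab
    have e2 : Rso v = Rso v' := congrArg Prod.snd hab
    subst e1
    obtain ⟨u, hu, rfl⟩ := Rv_inj (congrArg Subtype.val e2)
    change C.R N s (φ (Rso v)) (Ulift v) = C.R N s (φ (Rso (act u v))) (Ulift (act u v))
    rw [← e2, Ulift_sign v u hu, C.R_const (hUD v) N s u (hN2 s v)]
  let H : C(unitInterval × SOG, SOG) := hQ.lift h fun a b hab => hinv a b hab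
  have hH : ∀ s v, H (s, Rso v) = C.R N s (φ (Rso v)) (Ulift v) := fun s v =>
    congrFun (congrArg DFunLike.coe (hQ.lift_comp h fun a b hab => hinv a b hab)) (s, v)
  refine ⟨⟨H, fun A => ?_, fun A => ?_⟩⟩
  · obtain ⟨v, rfl⟩ := Rso_surj A
    change H (0, Rso v) = Rso v
    rw [hH]
    apply Subtype.ext
    simp only [Cov.R, Set.Icc.coe_zero]
    rw [C.Gam_zero, dl_Ulift, Tm_one]
    change Rv (Uact v e3) = Rv v
    rw [Uact_e3]
  · obtain ⟨v, rfl⟩ := Rso_surj A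
    change H (1, Rso v) = r0 ⟨φ (Rso v), hφ _⟩
    rw [hH, r0_eq _ (Ulift v) (hU v)]
    simp

end S19

theorem stmt_19
    -- the inclusion of `SO(3)` into `Map₁(S²)`, acting by rotations
    (incl : SO3 ⟶ Map1S2)
    (hincl : ∀ (A : Matrix.specialOrthogonalGroup (Fin 3) ℝ) (v : Sph2),
      (((incl A).1 v : EuclideanSpace ℝ (Fin 3))) =
        Matrix.mulVec (A : Matrix (Fin 3) (Fin 3) ℝ) (v : EuclideanSpace ℝ (Fin 3)))
    -- any field of coefficients
    (F : Type) [Field F] (n : ℕ) :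
    Function.Injective ((SingularHomology F n).map incl) := by
  have : CompactSpace SO3 := S19.compact_SO3
  refine S19.injective_of_compact_retract incl (fun K hK hiK => ?_) F n
  let M := {f : C(Sph2, Sph2) // Joined (ContinuousMap.id Sph2) f}
  let vl : C(M, C(Sph2, Sph2)) := ⟨Subtype.val, continuous_subtype_val⟩
  let i0 : C(S19.SOG, M) := incl.hom
  let K' : Set C(Sph2, Sph2) := vl '' (K : Set M)
  have hK' : IsCompact K' := IsCompact.image hK vl.continuous
  have hl : ∀ f ∈ K', ∃ F, S19.IsLift f F := by
    rintro f ⟨g, -, rfl⟩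
    exact S19.exists_lift g.2
  obtain ⟨r, ⟨H⟩⟩ := S19.core K' hK' hl (vl.comp i0) (fun A => ⟨i0 A, hiK A, rfl⟩)
    (fun A x => hincl A x)
  let j : C((K : Set M), K') := ⟨fun g => ⟨vl g.1, g.1, g.2, rfl⟩, by fun_prop⟩
  let r' : TopCat.of K ⟶ SO3 := TopCat.ofHom (r.comp j)
  exact ⟨r', ⟨H.symm⟩⟩
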